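/- Let Γ and Δ be countable discrete groups and let A be any Borel subset of Free(ℕ^{Γ*Δ}). Then at least one of the following holds: (1) there is an injective Borel function f : Free(ℕ^Γ) → Free(ℕ^{Γ*Δ}) that is equivariant with respect to the left shift actions of Γ on these spaces and such that ran(f) ⊆ A; or (2) there is an injective Borel function f : Free(ℕ^Δ) → Free(ℕ^{Γ*Δ}) that is equivariant with respect to the left shift actions of Δ on these spaces and such that ran(f) ⊆ X \ A, the complement of A. -/

import Mathlib

/-- The left shift action of a group `G` on the product space `G → X`:
`(γ • y) β = y (γ⁻¹ * β)`. -/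
def shift {G : Type*} [Group G] {X : Type*} (γ : G) (y : G → X) : G → X :=
  fun β => y (γ⁻¹ * β)

/-- The free part `Free(X^G)` of the left shift action of `G` on `G → X`. -/
def freePart (G : Type*) [Group G] (X : Type*) : Set (G → X) :=
  {y | ∀ γ : G, γ ≠ 1 → shift γ y ≠ y}

open PiNat (res)

namespace BorelGame

universe u

variable {U : Type u}

/-! ### Game trees

Positions are lists of moves, the latest move first; a play `x : ℕ → U` passes through the
positions `res x n`. Player `p` (`0` or `1`) moves at the positions whose length has parity `p`. -/

/-- A nonempty pruned tree of positions. -/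
structure IsGameTree (T : Set (List U)) : Prop where
  nil : [] ∈ T
  tail : ∀ a h, a :: h ∈ T → h ∈ T
  ext : ∀ h ∈ T, ∃ a, a :: h ∈ T

/-- The infinite plays of a tree. -/
def plays (T : Set (List U)) : Set (ℕ → U) := {x | ∀ n, res x n ∈ T}

/-- The strategy `s` for player `p` makes only moves allowed by `T`. -/
def Legal (p : ℕ) (T : Set (List U)) (s : List U → U) : Prop :=
  ∀ h ∈ T, h.length % 2 = p → s h :: h ∈ T

/-- In the play `x`, player `p` follows the strategy `s`. -/
def Follows (p : ℕ) (s : List U → U) (x : ℕ → U) : Prop :=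
  ∀ n, n % 2 = p → x n = s (res x n)

/-- Membership in `D` is decided at a finite stage of each play of `T`. -/
def Decided (T : Set (List U)) (D : Set (ℕ → U)) : Prop :=
  ∀ x ∈ plays T, ∃ n, ∀ y ∈ plays T, res y n = res x n → (y ∈ D ↔ x ∈ D)

/-- A move allowed by `T`, depending only on the set of allowed moves. -/
noncomputable def someMove [Nonempty U] (T : Set (List U)) (h : List U) : U :=
  Classical.epsilon (fun a => a ∈ {a | a :: h ∈ T})

lemma someMove_mem [Nonempty U] {T : Set (List U)} (hT : IsGameTree T) {h : List U} (hh : h ∈ T) :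
    someMove T h :: h ∈ T :=
  Classical.epsilon_spec (p := fun a => a ∈ {a | a :: h ∈ T}) (hT.ext h hh)

open Classical in
/-- Replace the illegal moves of a strategy by legal ones. -/
noncomputable def legalize [Nonempty U] (T : Set (List U)) (s : List U → U) (h : List U) : U :=
  if s h :: h ∈ T then s h else someMove T h

lemma legalize_mem [Nonempty U] {T : Set (List U)} (hT : IsGameTree T) (s : List U → U)
    {h : List U} (hh : h ∈ T) : legalize T s h :: h ∈ T := by
  unfold legalize
  split_ifs with h1
  · exact h1
  · exact someMove_mem hT hh

lemma legalize_eq [Nonempty U] {T : Set (List U)} {s : List U → U} {h : List U}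
    (hh : s h :: h ∈ T) : legalize T s h = s h := if_pos hh

lemma legalize_congr [Nonempty U] {T T' : Set (List U)} {s s' : List U → U} {h : List U}
    (hT : ∀ a, a :: h ∈ T ↔ a :: h ∈ T') (hs : s h = s' h) :
    legalize T s h = legalize T' s' h := by
  have : {a | a :: h ∈ T} = {a | a :: h ∈ T'} := Set.ext hT
  unfold legalize someMove
  rw [this, hs, hT]

/-! ### Safety and reachability -/

/-- Inside `S ⊆ R`, player `p` can avoid `W` forever while the opponent moves freely in `R`. -/
structure IsSafe (p : ℕ) (R W S : Set (List U)) : Prop where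
  sub : S ⊆ R
  avoid : ∀ h ∈ S, h ∉ W
  own : ∀ h ∈ S, h.length % 2 = p → ∃ a, a :: h ∈ S
  opp : ∀ h ∈ S, h.length % 2 ≠ p → ∀ a, a :: h ∈ R → a :: h ∈ S

/-- The positions of `R` from which player `p` can avoid `W` forever. -/
def Safe (p : ℕ) (R W : Set (List U)) : Set (List U) := {h | ∃ S, IsSafe p R W S ∧ h ∈ S}

lemma isSafe_safe (p : ℕ) (R W : Set (List U)) : IsSafe p R W (Safe p R W) where
  sub := fun _ ⟨_, hS, h⟩ => hS.sub h
  avoid := fun _ ⟨_, hS, h⟩ => hS.avoid _ h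
  own := fun _ ⟨S, hS, h⟩ hp => (hS.own _ h hp).imp fun _ ha => ⟨S, hS, ha⟩
  opp := fun _ ⟨S, hS, h⟩ hp a ha => ⟨S, hS, hS.opp _ h hp a ha⟩

/-- The opponent of player `p` can reach `W` inside `R` within rank `α`. -/
inductive Attr (p : ℕ) (R W : Set (List U)) : Ordinal.{u} → List U → Prop
  | base (α : Ordinal.{u}) (h : List U) (hW : h ∈ W) : Attr p R W α h
  | opp (α β : Ordinal.{u}) (h : List U) (a : U) (hp : h.length % 2 ≠ p) (ha : a :: h ∈ R)
      (hβ : β < α) (hA : Attr p R W β (a :: h)) : Attr p R W α h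
  | own (α : Ordinal.{u}) (h : List U) (f : U → Ordinal.{u}) (hp : h.length % 2 = p)
      (hf : ∀ a, a :: h ∈ R → f a < α) (hA : ∀ a, a :: h ∈ R → Attr p R W (f a) (a :: h)) :
      Attr p R W α h

lemma mem_safe_of_not_attr {p : ℕ} {R W : Set (List U)} {h : List U} (hR : h ∈ R)
    (hA : ∀ α, ¬ Attr p R W α h) : h ∈ Safe p R W := by
  refine ⟨{h | h ∈ R ∧ ∀ α, ¬ Attr p R W α h}, ⟨fun h hh => hh.1, ?_, ?_, ?_⟩, hR, hA⟩
  · exact fun h hh hW => hh.2 0 (.base 0 h hW)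
  · rintro h ⟨-, hA⟩ hp
    by_contra! hc
    have : ∀ a, ∃ β, a :: h ∈ R → Attr p R W β (a :: h) := by
      intro a
      by_contra! hcon
      exact hc a ⟨(hcon 0).1, fun α => (hcon α).2⟩
    choose f hf using this
    refine hA (⨆ a, Order.succ (f a)) (.own _ h f hp (fun a _ => ?_) hf)
    exact (Order.lt_succ _).trans_le (Ordinal.le_iSup (fun a => Order.succ (f a)) a)
  · rintro h ⟨-, hA⟩ hp a ha
    exact ⟨ha, fun α hα => hA _ (.opp (Order.succ α) α h a hp ha (Order.lt_succ _) hα)⟩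

/-- From the positions of `R` that are not safe for player `p`, the opponent can force a visit
to `W` with a single positional strategy. -/
lemma exists_reach [Nonempty U] (p : ℕ) (R W : Set (List U)) : ∃ t : List U → U,
    (∀ h, (∃ a, a :: h ∈ R) → t h :: h ∈ R) ∧
    ∀ (x : ℕ → U) (n : ℕ), (∀ m ≥ n, res x m ∈ R) →
      (∀ m ≥ n, m % 2 ≠ p → x m = t (res x m)) → res x n ∉ Safe p R W →
      ∃ m ≥ n, res x m ∈ W := by
  classical
  let rk : List U → Ordinal.{u} := fun h => sInf {α | Attr p R W α h}
  let A : Set (List U) := {h | ∃ α, Attr p R W α h}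
  have hrk : ∀ h ∈ A, Attr p R W (rk h) h := fun h hh => csInf_mem hh
  have hle : ∀ h α, Attr p R W α h → rk h ≤ α := fun h α hα => csInf_le' hα
  let P : List U → U → Prop := fun h a => a :: h ∈ R ∧ a :: h ∈ A ∧ rk (a :: h) < rk h
  let t : List U → U := fun h => if ∃ a, P h a then Classical.epsilon (P h) else someMove R h
  have hA : ∀ h ∈ R, h ∉ Safe p R W → h ∈ A := by
    intro h hR hS
    by_contra hc
    exact hS (mem_safe_of_not_attr hR (fun α hα => hc ⟨α, hα⟩))
  have hopp : ∀ h ∈ A, h ∉ W → h.length % 2 ≠ p → P h (t h) := by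
    intro h hh hW hp
    suffices hex : ∃ a, P h a by
      simp only [t, if_pos hex]
      exact Classical.epsilon_spec hex
    cases hrk h hh with
    | base _ _ hW' => exact absurd hW' hW
    | opp _ β _ a _ ha hβ hAt => exact ⟨a, ha, ⟨β, hAt⟩, (hle _ _ hAt).trans_lt hβ⟩
    | own _ _ f hp' => exact absurd hp' hp
  have hown : ∀ h ∈ A, h ∉ W → h.length % 2 = p → ∀ a, a :: h ∈ R → P h a := by
    intro h hh hW hp a ha
    cases hrk h hh with
    | base _ _ hW' => exact absurd hW' hW
    | opp _ β _ a hp' => exact absurd hp hp'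
    | own _ _ f _ hf hAt => exact ⟨ha, ⟨_, hAt a ha⟩, (hle _ _ (hAt a ha)).trans_lt (hf a ha)⟩
  refine ⟨t, fun h hR => ?_, ?_⟩
  · by_cases hex : ∃ a, P h a
    · simp only [t, if_pos hex]
      exact (Classical.epsilon_spec hex).1
    · simp only [t, if_neg hex]
      exact Classical.epsilon_spec (p := fun a => a ∈ {a | a :: h ∈ R}) hR
  intro x n hx ht hn
  by_contra! hW
  have key : ∀ m ≥ n, res x m ∈ A → P (res x m) (x m) := by
    intro m hm hmA
    by_cases hp : m % 2 = p
    · exact hown _ hmA (hW m hm) (by simpa using hp) _ (by simpa using hx (m + 1) (by omega))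
    · rw [ht m hm hp]
      exact hopp _ hmA (hW m hm) (by simpa using hp)
  have hall : ∀ k, res x (n + k) ∈ A := by
    intro k
    induction k with
    | zero => exact hA _ (hx n le_rfl) hn
    | succ k ih => exact (key _ (by omega) ih).2.1
  obtain ⟨k, hk⟩ := WellFounded.not_rel_apply_succ (r := (· < · : Ordinal.{u} → _ → Prop))
    (fun k => rk (res x (n + k)))
  exact hk (key _ (by omega) (hall k)).2.2

/-- Determinacy of games that are decided at finite stages. -/
theorem decided_determinacy [Nonempty U] {T : Set (List U)} (hT : IsGameTree T)
    {D : Set (ℕ → U)} (hD : Decided T D) :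
    (∃ s, Legal 0 T s ∧ ∀ x ∈ plays T, Follows 0 s x → x ∈ D) ∨
    (∃ s, Legal 1 T s ∧ ∀ x ∈ plays T, Follows 1 s x → x ∉ D) := by
  let B : Set (List U) := {h | ∀ x ∈ plays T, res x h.length = h → x ∈ D}
  by_cases h0 : [] ∈ Safe 1 T B
  · right
    have hsafe := isSafe_safe 1 T B
    have : ∀ h, ∃ a, h ∈ T → (h ∈ Safe 1 T B → h.length % 2 = 1 → a :: h ∈ Safe 1 T B) ∧
        a :: h ∈ T := by
      intro h
      by_cases hh : h ∈ Safe 1 T B ∧ h.length % 2 = 1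
      · obtain ⟨a, ha⟩ := hsafe.own h hh.1 hh.2
        exact ⟨a, fun _ => ⟨fun _ _ => ha, hsafe.sub ha⟩⟩
      · by_cases hhT : h ∈ T
        · obtain ⟨a, ha⟩ := hT.ext h hhT
          exact ⟨a, fun _ => ⟨fun h1 h2 => absurd ⟨h1, h2⟩ hh, ha⟩⟩
        · exact ⟨Classical.arbitrary U, fun h' => absurd h' hhT⟩
    choose s hs using this
    refine ⟨s, fun h hh _ => (hs h hh).2, fun x hx hf hxD => ?_⟩
    have hall : ∀ n, res x n ∈ Safe 1 T B := by
      intro n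
      induction n with
      | zero => exact h0
      | succ n ih =>
        rw [PiNat.res_succ]
        by_cases hn : n % 2 = 1
        · rw [hf n hn]
          exact (hs _ (hx n)).1 ih (by simpa using hn)
        · exact hsafe.opp _ ih (by simpa using hn) _ (by simpa using hx (n + 1))
    obtain ⟨n, hn⟩ := hD x hx
    refine hsafe.avoid _ (hall n) ?_
    intro y hy hyn
    rw [PiNat.res_length] at hyn
    exact (hn y hy hyn).2 hxD
  · left
    obtain ⟨t, htl, ht⟩ := exists_reach 1 T B
    refine ⟨t, fun h hh _ => htl h (hT.ext h hh), fun x hx hf => ?_⟩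
    obtain ⟨m, -, hm⟩ := ht x 0 (fun m _ => hx m) (fun m _ hp => hf m (by omega)) h0
    exact hm x hx (by rw [PiNat.res_length])

/-! ### Coverings -/

/-- A covering of the game tree `T` by `T'` which is the identity up to stage `k`: positions of
`T'` are projected to `T` by `π`, strategies are transferred by `φ`, and plays against a
transferred strategy lift to plays against the original one. -/
structure Cover (k : ℕ) (T' T : Set (List U)) (π : List U → List U)
    (φ : ℕ → (List U → U) → List U → U) : Prop where
  len : ∀ h, (π h).length = h.length
  tail : ∀ a h, ∃ b, π (a :: h) = b :: π h
  maps : ∀ h ∈ T', π h ∈ T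
  legal : ∀ p < 2, ∀ s, Legal p T' s → Legal p T (φ p s)
  loc : ∀ p < 2, ∀ n s s', (∀ h, h.length ≤ n → s h = s' h) →
    ∀ h, h.length ≤ n → φ p s h = φ p s' h
  lift : ∀ p < 2, ∀ s, Legal p T' s → ∀ x ∈ plays T, Follows p (φ p s) x →
    ∃ x' ∈ plays T', Follows p s x' ∧ ∀ n, π (res x' n) = res x n
  mem : ∀ h, h.length ≤ k → (h ∈ T' ↔ h ∈ T)
  pos : ∀ h, h.length ≤ k → π h = h
  str : ∀ p < 2, ∀ s h, h.length < k → φ p s h = s h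

lemma Cover.id (k : ℕ) (T : Set (List U)) : Cover k T T id fun _ => id where
  len _ := rfl
  tail a _ := ⟨a, rfl⟩
  maps _ hh := hh
  legal _ _ _ hs := hs
  loc _ _ _ _ _ hs := hs
  lift _ _ _ _ x hx hf := ⟨x, hx, hf, fun _ => rfl⟩
  mem _ _ := Iff.rfl
  pos _ _ := rfl
  str _ _ _ _ _ := rfl

lemma Cover.comp {k : ℕ} {T'' T' T : Set (List U)} {π' π : List U → List U}
    {φ' φ : ℕ → (List U → U) → List U → U} (h' : Cover k T'' T' π' φ') (h : Cover k T' T π φ) :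
    Cover k T'' T (π ∘ π') (fun p => φ p ∘ φ' p) where
  len g := by simp [h.len, h'.len]
  tail a g := by
    obtain ⟨b, hb⟩ := h'.tail a g
    obtain ⟨c, hc⟩ := h.tail b (π' g)
    exact ⟨c, by simp [hb, hc]⟩
  maps g hg := h.maps _ (h'.maps _ hg)
  legal p hp s hs := h.legal p hp _ (h'.legal p hp s hs)
  loc p hp n s s' hs := h.loc p hp n _ _ (h'.loc p hp n s s' hs)
  lift p hp s hs x hx hf := by
    obtain ⟨x', hx', hf', he'⟩ := h.lift p hp _ (h'.legal p hp s hs) x hx hf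
    obtain ⟨y, hy, hfy, hey⟩ := h'.lift p hp s hs x' hx' hf'
    exact ⟨y, hy, hfy, fun n => by simp [hey, he']⟩
  mem g hg := (h'.mem g hg).trans (h.mem g hg)
  pos g hg := by simp [h'.pos g hg, h.pos g hg]
  str p hp s g hg := by simp [h.str p hp _ g hg, h'.str p hp _ g hg]

lemma Cover.mono {k l : ℕ} (hkl : k ≤ l) {T' T : Set (List U)} {π : List U → List U}
    {φ : ℕ → (List U → U) → List U → U} (h : Cover l T' T π φ) : Cover k T' T π φ where
  len := h.len
  tail := h.tail
  maps := h.maps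
  legal := h.legal
  loc := h.loc
  lift := h.lift
  mem g hg := h.mem g (hg.trans hkl)
  pos g hg := h.pos g (hg.trans hkl)
  str p hp s g hg := h.str p hp s g (hg.trans_le hkl)

lemma eq_of_res_eq {x y : ℕ → U} (h : ∀ n, res x n = res y n) : x = y := by
  funext n
  exact PiNat.res_eq_res.1 (h (n + 1)) (Nat.lt_succ_self n)

section

variable [Inhabited U]

/-- The map on plays induced by a map on positions. -/
def lim (π : List U → List U) (x : ℕ → U) (n : ℕ) : U := (π (res x (n + 1))).headI

lemma res_lim {π : List U → List U} (len : ∀ h, (π h).length = h.length)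
    (tail : ∀ a h, ∃ b, π (a :: h) = b :: π h) (x : ℕ → U) (n : ℕ) :
    res (lim π x) n = π (res x n) := by
  induction n with
  | zero => exact (List.eq_nil_of_length_eq_zero (by simp [len])).symm
  | succ n ih =>
    obtain ⟨b, hb⟩ := tail (x n) (res x n)
    rw [PiNat.res_succ, ih, lim, PiNat.res_succ, hb, List.headI]

lemma lim_comp {π π' : List U → List U} (len : ∀ h, (π h).length = h.length)
    (tail : ∀ a h, ∃ b, π (a :: h) = b :: π h) (len' : ∀ h, (π' h).length = h.length)
    (tail' : ∀ a h, ∃ b, π' (a :: h) = b :: π' h) (x : ℕ → U) :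
    lim (π ∘ π') x = lim π (lim π' x) := by
  refine eq_of_res_eq fun n => ?_
  rw [res_lim, res_lim len tail, res_lim len' tail', Function.comp]
  · exact fun h => by simp [len, len']
  · intro a h
    obtain ⟨b, hb⟩ := tail' a h
    obtain ⟨c, hc⟩ := tail b (π' h)
    exact ⟨c, by simp [hb, hc]⟩

lemma Cover.lim_comp {k l : ℕ} {T'' T' T : Set (List U)} {π' π : List U → List U}
    {φ' φ : ℕ → (List U → U) → List U → U} (h' : Cover l T'' T' π' φ') (h : Cover k T' T π φ)
    (x : ℕ → U) : lim (π ∘ π') x = lim π (lim π' x) :=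
  BorelGame.lim_comp h.len h.tail h'.len h'.tail x

variable {k : ℕ} {T' T : Set (List U)} {π : List U → List U} {φ : ℕ → (List U → U) → List U → U}

lemma Cover.res_lim (h : Cover k T' T π φ) (x : ℕ → U) (n : ℕ) :
    res (lim π x) n = π (res x n) :=
  BorelGame.res_lim h.len h.tail x n

lemma Cover.lim_mem (h : Cover k T' T π φ) {x : ℕ → U} (hx : x ∈ plays T') :
    lim π x ∈ plays T := fun n => by
  rw [h.res_lim]
  exact h.maps _ (hx n)

lemma Cover.decided (h : Cover k T' T π φ) {D : Set (ℕ → U)} (hD : Decided T D) :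
    Decided T' {x | lim π x ∈ D} := fun x hx => by
  obtain ⟨n, hn⟩ := hD _ (h.lim_mem hx)
  refine ⟨n, fun y hy hxy => hn _ (h.lim_mem hy) ?_⟩
  rw [h.res_lim, h.res_lim, hxy]

lemma Cover.determined (h : Cover k T' T π φ) {D : Set (ℕ → U)}
    (hD : (∃ s, Legal 0 T' s ∧ ∀ x ∈ plays T', Follows 0 s x → lim π x ∈ D) ∨
      (∃ s, Legal 1 T' s ∧ ∀ x ∈ plays T', Follows 1 s x → lim π x ∉ D)) :
    (∃ s, Legal 0 T s ∧ ∀ x ∈ plays T, Follows 0 s x → x ∈ D) ∨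
    (∃ s, Legal 1 T s ∧ ∀ x ∈ plays T, Follows 1 s x → x ∉ D) := by
  have key : ∀ p < 2, ∀ s, Legal p T' s → ∀ x ∈ plays T, Follows p (φ p s) x →
      ∃ x' ∈ plays T', Follows p s x' ∧ lim π x' = x := by
    intro p hp s hs x hx hf
    obtain ⟨x', hx', hf', he⟩ := h.lift p hp s hs x hx hf
    exact ⟨x', hx', hf', eq_of_res_eq fun n => by rw [h.res_lim, he]⟩
  refine hD.imp ?_ ?_
  · rintro ⟨s, hs, hw⟩
    refine ⟨φ 0 s, h.legal 0 (by norm_num) s hs, fun x hx hf => ?_⟩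
    obtain ⟨x', hx', hf', rfl⟩ := key 0 (by norm_num) s hs x hx hf
    exact hw x' hx' hf'
  · rintro ⟨s, hs, hw⟩
    refine ⟨φ 1 s, h.legal 1 (by norm_num) s hs, fun x hx hf => ?_⟩
    obtain ⟨x', hx', hf', rfl⟩ := key 1 (by norm_num) s hs x hx hf
    exact hw x' hx' hf'

end

/-! ### Limits of coverings -/

/-- The composition `π i ∘ ⋯ ∘ π (i + d - 1)`. -/
def compPos (π : ℕ → List U → List U) : ℕ → ℕ → List U → List U
  | _, 0 => id
  | i, d + 1 => π i ∘ compPos π (i + 1) d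

/-- The composition `φ i ∘ ⋯ ∘ φ (i + d - 1)`. -/
def compStr (φ : ℕ → ℕ → (List U → U) → List U → U) : ℕ → ℕ → ℕ → (List U → U) → List U → U
  | _, 0, _ => id
  | i, d + 1, p => φ i p ∘ compStr φ (i + 1) d p

lemma compPos_succ (π : ℕ → List U → List U) (i d : ℕ) :
    compPos π i (d + 1) = compPos π i d ∘ π (i + d) := by
  induction d generalizing i with
  | zero => rfl
  | succ d ih =>
    rw [compPos, ih, compPos, Function.comp_assoc, Nat.add_right_comm, Nat.add_assoc]

lemma compStr_succ (φ : ℕ → ℕ → (List U → U) → List U → U) (i d p : ℕ) :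
    compStr φ i (d + 1) p = compStr φ i d p ∘ φ (i + d) p := by
  induction d generalizing i with
  | zero => rfl
  | succ d ih =>
    rw [compStr, ih, compStr, Function.comp_assoc, Nat.add_right_comm, Nat.add_assoc]

/-- The limit of a sequence of trees. -/
def limTree (T : ℕ → Set (List U)) : Set (List U) := {h | h ∈ T h.length}

/-- The limit of the position maps. -/
def limPos (π : ℕ → List U → List U) (i : ℕ) (h : List U) : List U := compPos π i h.length h

/-- The limit of the strategy maps. -/
noncomputable def limStr [Nonempty U] (T : ℕ → Set (List U))
    (φ : ℕ → ℕ → (List U → U) → List U → U) (i p : ℕ) (s : List U → U) (h : List U) : U :=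
  compStr φ i (h.length + 1) p (legalize (T (i + (h.length + 1))) s) h

section

variable {k : ℕ} {T : ℕ → Set (List U)} {π : ℕ → List U → List U}
  {φ : ℕ → ℕ → (List U → U) → List U → U}

lemma comp_cover (hc : ∀ i, Cover (k + i) (T (i + 1)) (T i) (π i) (φ i)) (i d : ℕ) :
    Cover (k + i) (T (i + d)) (T i) (compPos π i d) (compStr φ i d) := by
  induction d generalizing i with
  | zero => exact Cover.id _ _
  | succ d ih =>
    have h := ih (i + 1)
    rw [Nat.add_right_comm, Nat.add_assoc] at h
    exact (h.mono (by omega)).comp (hc i)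

lemma mem_limTree (hc : ∀ i, Cover (k + i) (T (i + 1)) (T i) (π i) (φ i)) {i : ℕ} {h : List U}
    (hi : h.length ≤ k + i) : h ∈ limTree T ↔ h ∈ T i := by
  have key : ∀ i j, i ≤ j → h.length ≤ k + i → (h ∈ T j ↔ h ∈ T i) := by
    intro i j hij hh
    induction j, hij using Nat.le_induction with
    | base => rfl
    | succ j hij ih => exact ((hc j).mem h (by omega)).trans ih
  rcases le_total i h.length with h1 | h1
  · exact key _ _ h1 hi
  · exact (key _ _ h1 (by omega)).symm

lemma isGameTree_limTree (hc : ∀ i, Cover (k + i) (T (i + 1)) (T i) (π i) (φ i))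
    (hT : ∀ i, IsGameTree (T i)) : IsGameTree (limTree T) where
  nil := (hT 0).nil
  tail a h hh := (mem_limTree hc (i := h.length + 1) (by omega)).2 ((hT _).tail a h hh)
  ext h hh := (hT _).ext h ((mem_limTree hc (i := h.length + 1) (by omega)).1 hh)

lemma limPos_eq (hc : ∀ i, Cover (k + i) (T (i + 1)) (T i) (π i) (φ i)) {i d : ℕ} {h : List U}
    (hd : h.length ≤ d) : compPos π i d h = limPos π i h := by
  induction d, hd using Nat.le_induction with
  | base => rfl
  | succ d hd ih =>
    rw [compPos_succ, Function.comp, (hc (i + d)).pos h (by omega), ih]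

lemma limPos_succ (hc : ∀ i, Cover (k + i) (T (i + 1)) (T i) (π i) (φ i)) (i : ℕ) :
    limPos π i = π i ∘ limPos π (i + 1) := by
  funext h
  rw [← limPos_eq hc (Nat.le_succ h.length)]
  rfl

lemma limPos_length (hc : ∀ i, Cover (k + i) (T (i + 1)) (T i) (π i) (φ i)) (i : ℕ)
    (h : List U) : (limPos π i h).length = h.length :=
  (comp_cover hc i _).len h

lemma limPos_cons (hc : ∀ i, Cover (k + i) (T (i + 1)) (T i) (π i) (φ i)) (i : ℕ) (a : U)
    (h : List U) : ∃ b, limPos π i (a :: h) = b :: limPos π i h := by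
  obtain ⟨b, hb⟩ := (comp_cover hc i (h.length + 1)).tail a h
  exact ⟨b, by rw [← limPos_eq hc (Nat.le_succ h.length)]; exact hb⟩

lemma limPos_mem (hc : ∀ i, Cover (k + i) (T (i + 1)) (T i) (π i) (φ i)) (i : ℕ) {h : List U}
    (hh : h ∈ limTree T) : limPos π i h ∈ T i :=
  (comp_cover hc i h.length).maps h ((mem_limTree hc (by omega)).1 hh)

variable [Nonempty U]

lemma limStr_eq (hc : ∀ i, Cover (k + i) (T (i + 1)) (T i) (π i) (φ i)) {i d p : ℕ} (hp : p < 2)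
    (s : List U → U) {h : List U} (hd : h.length + 1 ≤ d) :
    compStr φ i d p (legalize (T (i + d)) s) h = limStr T φ i p s h := by
  induction d, hd using Nat.le_induction with
  | base => rfl
  | succ d hd ih =>
    rw [compStr_succ, Function.comp, ← ih]
    refine (comp_cover hc i d).loc p hp h.length _ _ (fun g hg => ?_) h le_rfl
    rw [(hc (i + d)).str p hp _ g (by omega)]
    exact legalize_congr (fun a => (hc (i + d)).mem _ (by simp; omega)) rfl

lemma limStr_legal (hc : ∀ i, Cover (k + i) (T (i + 1)) (T i) (π i) (φ i))
    (hT : ∀ i, IsGameTree (T i)) (i : ℕ) {p : ℕ} (hp : p < 2) (s : List U → U) :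
    Legal p (T i) (limStr T φ i p s) := fun h hh hl =>
  (comp_cover hc i (h.length + 1)).legal p hp _
    (fun _ hg _ => legalize_mem (hT _) s hg) h hh hl

lemma limStr_succ (hc : ∀ i, Cover (k + i) (T (i + 1)) (T i) (π i) (φ i)) (i : ℕ) {p : ℕ}
    (hp : p < 2) (s : List U → U) : limStr T φ i p s = φ i p (limStr T φ (i + 1) p s) := by
  funext h
  rw [← limStr_eq hc hp s (Nat.le_succ (h.length + 1)), compStr, Function.comp]
  refine (hc i).loc p hp h.length _ _ (fun g hg => ?_) h le_rfl
  rw [← limStr_eq hc hp s (i := i + 1) (d := h.length + 1) (by omega), Nat.add_right_comm i 1,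
    Nat.add_assoc i]

lemma limStr_of_legal (hc : ∀ i, Cover (k + i) (T (i + 1)) (T i) (π i) (φ i)) {i p : ℕ}
    (hp : p < 2) {s : List U → U} {h : List U} (hh : s h :: h ∈ limTree T)
    (hl : h.length < k + i) : limStr T φ i p s h = s h := by
  rw [limStr, (comp_cover hc i _).str p hp _ h hl, legalize_eq]
  exact (mem_limTree hc (by simp; omega)).1 hh

lemma limit_lift (hc : ∀ i, Cover (k + i) (T (i + 1)) (T i) (π i) (φ i))
    (hT : ∀ i, IsGameTree (T i)) {p : ℕ} (hp : p < 2) {s : List U → U}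
    (hs : Legal p (limTree T) s) {x : ℕ → U} (hx : x ∈ plays (T 0))
    (hf : Follows p (limStr T φ 0 p s) x) :
    ∃ x' ∈ plays (limTree T), Follows p s x' ∧ ∀ n, limPos π 0 (res x' n) = res x n := by
  have step : ∀ i x, (x ∈ plays (T i) ∧ Follows p (limStr T φ i p s) x) →
      ∃ y, (y ∈ plays (T (i + 1)) ∧ Follows p (limStr T φ (i + 1) p s) y) ∧
        ∀ n, π i (res y n) = res x n := by
    rintro i x ⟨hx, hf⟩
    rw [limStr_succ hc i hp s] at hf
    obtain ⟨y, hy, hfy, he⟩ := (hc i).lift p hp _ (limStr_legal hc hT (i + 1) hp s) x hx hf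
    exact ⟨y, ⟨hy, hfy⟩, he⟩
  choose! g hg he using step
  let X : ℕ → ℕ → U := fun i => Nat.rec x (fun i y => g i y) i
  have hX : ∀ i, X i ∈ plays (T i) ∧ Follows p (limStr T φ i p s) (X i) := by
    intro i
    induction i with
    | zero => exact ⟨hx, hf⟩
    | succ i ih => exact hg i (X i) ih
  have hXπ : ∀ i n, π i (res (X (i + 1)) n) = res (X i) n := fun i n => he i (X i) (hX i) n
  have hstab : ∀ i j n, i ≤ j → n ≤ k + i → res (X j) n = res (X i) n := by
    intro i j n hij hn
    induction j, hij using Nat.le_induction with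
    | base => rfl
    | succ j hij ih =>
      rw [← ih, ← hXπ j n, (hc j).pos _ (by rw [PiNat.res_length]; omega)]
  let x' : ℕ → U := fun n => X (n + 1) n
  have hx' : ∀ i n, n ≤ k + i → res x' n = res (X i) n := by
    intro i n hn
    rw [PiNat.res_eq_res]
    intro m hm
    rcases le_total (m + 1) i with h1 | h1
    · exact (PiNat.res_eq_res.1 (hstab (m + 1) i (m + 1) h1 (by omega)) (Nat.lt_succ_self m)).symm
    · exact PiNat.res_eq_res.1 (hstab i (m + 1) (m + 1) h1 (by omega)) (Nat.lt_succ_self m)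
  have hplay : x' ∈ plays (limTree T) := by
    intro n
    rw [mem_limTree hc (i := n) (by rw [PiNat.res_length]; omega), hx' n n (by omega)]
    exact (hX n).1 n
  refine ⟨x', hplay, fun n hn => ?_, fun n => ?_⟩
  · change X (n + 1) n = _
    rw [(hX (n + 1)).2 n hn, ← hx' (n + 1) n (by omega)]
    exact limStr_of_legal hc hp (hs _ (hplay n) (by simpa using hn))
      (by rw [PiNat.res_length]; omega)
  · have : ∀ d i, compPos π i d (res (X (i + d)) n) = res (X i) n := by
      intro d
      induction d with
      | zero => exact fun i => rfl
      | succ d ih =>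
        intro i
        rw [compPos, Function.comp, ← Nat.add_assoc, Nat.add_right_comm, ih (i + 1), hXπ]
    have h0 := this n 0
    rw [Nat.zero_add] at h0
    rw [limPos, PiNat.res_length, hx' n n (by omega), h0]
    rfl

open Classical in
theorem limit_cover (hc : ∀ i, Cover (k + i) (T (i + 1)) (T i) (π i) (φ i))
    (hT : ∀ i, IsGameTree (T i)) :
    Cover k (limTree T) (T 0) (limPos π 0)
      (fun p s h => if h.length < k then s h else limStr T φ 0 p s h) where
  len := limPos_length hc 0
  tail := limPos_cons hc 0
  maps _ hh := limPos_mem hc 0 hh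
  legal p hp s hs h hh hl := by
    beta_reduce
    split_ifs with hk
    · rw [← mem_limTree hc (by simp; omega)]
      exact hs h ((mem_limTree hc (by omega)).2 hh) hl
    · exact limStr_legal hc hT 0 hp s h hh hl
  loc p hp n s s' hs h hh := by
    rw [hs h hh]
    have : limStr T φ 0 p s h = limStr T φ 0 p s' h :=
      (comp_cover hc 0 _).loc p hp h.length _ _
        (fun g hg => legalize_congr (fun _ => Iff.rfl) (hs g (by omega))) h le_rfl
    rw [this]
  lift p hp s hs x hx hf := by
    refine limit_lift hc hT hp hs hx fun n hn => ?_
    have := hf n hn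
    simp only [PiNat.res_length] at this
    rw [this]
    split_ifs with hk
    · refine (limStr_of_legal hc hp (hs _ ?_ (by simpa using hn)) (by simpa using hk)).symm
      exact (mem_limTree hc (by rw [PiNat.res_length]; omega)).2 (hx n)
    · rfl
  mem h hh := mem_limTree hc (by omega)
  pos h hh := (comp_cover hc 0 _).pos h (by omega)
  str p hp s h hh := if_pos hh

end

/-! ### Positions as initial segments of sequences -/

section

variable [Inhabited U]

/-- A sequence extending the position `h`. -/
def seq : List U → ℕ → U
  | [], _ => default
  | a :: h, n => if n = h.length then a else seq h n

omit [Inhabited U] in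
lemma res_congr {x y : ℕ → U} {n : ℕ} (h : ∀ m < n, x m = y m) : res x n = res y n :=
  PiNat.res_eq_res.2 fun _ hm => h _ hm

lemma res_seq (h : List U) : res (seq h) h.length = h := by
  induction h with
  | nil => rfl
  | cons a h ih =>
    rw [List.length_cons, PiNat.res_succ]
    congr 1
    · simp [seq]
    · rw [← ih, PiNat.res_length]
      refine res_congr fun m hm => ?_
      rw [ih, seq, if_neg hm.ne]

lemma seq_res {x : ℕ → U} {m n : ℕ} (h : m < n) : seq (res x n) m = x m := by
  have := res_seq (res x n)
  rw [PiNat.res_length, PiNat.res_eq_res] at this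
  exact this h

omit [Inhabited U] in
lemma cons_res (a : U) (x : ℕ → U) (n : ℕ) :
    a :: res x n = res (Function.update x n a) (n + 1) := by
  rw [PiNat.res_succ, Function.update_self]
  congr 1
  exact res_congr fun m hm => by rw [Function.update_of_ne hm.ne]

omit [Inhabited U] in
lemma mem_of_le {T : Set (List U)} (hT : IsGameTree T) {x : ℕ → U} {m n : ℕ} (hmn : m ≤ n)
    (h : res x n ∈ T) : res x m ∈ T := by
  induction n, hmn using Nat.le_induction with
  | base => exact h
  | succ n hmn ih => exact ih (hT.tail _ _ h)

end

lemma eq_safe_empty {T : Set (List U)} (hT : IsGameTree T) (p : ℕ) : Safe p T ∅ = T :=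
  Set.Subset.antisymm (isSafe_safe p T ∅).sub fun _ hh =>
    ⟨T, ⟨subset_rfl, fun _ _ => id, fun h hh _ => hT.ext h hh, fun _ _ _ _ => id⟩, hh⟩

/-! ### The auxiliary game for an open set -/

/-- A way to code into a single move a move of `T`, a set of positions and possibly one more
position. -/
structure Coding (T : Set (List U)) where
  C : Set U
  mv : U → U
  W : U → Set (List U)
  O : U → Option (List U)
  K : U → Set (List U) → Option (List U) → U
  ok : ∀ a h W' o, a :: h ∈ T → W' ⊆ T → (∀ u ∈ o, u ∈ T) →
    K a W' o ∈ C ∧ mv (K a W' o) = a ∧ W (K a W' o) = W' ∧ O (K a W' o) = o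

namespace Coding

variable {T : Set (List U)} (κ : Coding T) (B : Set (List U)) (N : ℕ)

/-- Forget the additional information in the moves number `N` and `N + 1`. -/
def proj (x : ℕ → U) (m : ℕ) : U := if m = N ∨ m = N + 1 then κ.mv (x m) else x m

/-- Replace the moves number `N` and `N + 1`. -/
def _root_.BorelGame.splice (c c' : U) (x : ℕ → U) (m : ℕ) : U :=
  if m = N then c else if m = N + 1 then c' else x m

/-- The positions from which player `0` can avoid the set coded by `c`. -/
def Sig (c : U) : Set (List U) := Safe 0 T (κ.W c)

/-- The positions from which player `1` can moreover avoid `B`. -/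
def Rej (c : U) : Set (List U) := Safe 1 (κ.Sig c) B

variable [Inhabited U]

/-- The first `n` moves of `x` are according to the rules of the auxiliary game: in move `N`
player `0` names a set of positions to be avoided, and in move `N + 1` player `1` either names
a position of `B` through which the play will pass, or promises that the play avoids `B`. -/
structure Valid (x : ℕ → U) (n : ℕ) : Prop where
  mem : res (κ.proj N x) n ∈ T
  code : N < n → x N ∈ κ.C
  sig : N < n → res (κ.proj N x) (N + 1) ∈ κ.Sig (x N)
  code' : N + 1 < n → x (N + 1) ∈ κ.C
  acc : N + 1 < n → ∀ u, κ.O (x (N + 1)) = some u →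
    u ∈ B ∧ u ∈ κ.Sig (x N) ∧ N + 2 ≤ u.length ∧
      ∀ j < n, j < u.length → κ.proj N x j = seq u j
  rej : N + 1 < n → κ.O (x (N + 1)) = none →
    ∀ j, N + 2 ≤ j → j ≤ n → res (κ.proj N x) j ∈ κ.Rej B (x N)

/-- The tree of the auxiliary game. -/
def tree : Set (List U) := {h | κ.Valid B N (seq h) h.length}

/-- The projection of positions of the auxiliary game. -/
def projPos (h : List U) : List U := res (κ.proj N (seq h)) h.length

variable {κ B N}

omit [Inhabited U] in
lemma proj_congr {x y : ℕ → U} {m : ℕ} (h : x m = y m) : κ.proj N x m = κ.proj N y m := by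
  unfold proj
  rw [h]

omit [Inhabited U] in
lemma proj_of_lt {x : ℕ → U} {m : ℕ} (h : m < N) : κ.proj N x m = x m :=
  if_neg (by omega)

omit [Inhabited U] in
lemma proj_of_ge {x : ℕ → U} {m : ℕ} (h : N + 2 ≤ m) : κ.proj N x m = x m :=
  if_neg (by omega)

omit [Inhabited U] in
lemma proj_splice {c c' : U} {x : ℕ → U} (hc : κ.mv c = x N) (hc' : κ.mv c' = x (N + 1)) :
    κ.proj N (splice N c c' x) = x := by
  funext m
  unfold proj splice
  rcases eq_or_ne m N with rfl | h1
  · simp [hc]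
  · rcases eq_or_ne m (N + 1) with rfl | h2
    · simp [hc']
    · simp [h1, h2]

omit [Inhabited U] in
lemma splice_lt {c c' : U} {x : ℕ → U} {m : ℕ} (h : m < N) : splice N c c' x m = x m := by
  unfold splice
  rw [if_neg (by omega), if_neg (by omega)]

omit [Inhabited U] in
lemma splice_ge {c c' : U} {x : ℕ → U} {m : ℕ} (h : N + 2 ≤ m) : splice N c c' x m = x m := by
  unfold splice
  rw [if_neg (by omega), if_neg (by omega)]

omit [Inhabited U] in
@[simp] lemma splice_self (c c' : U) (x : ℕ → U) : splice N c c' x N = c := if_pos rfl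

omit [Inhabited U] in
@[simp] lemma splice_succ (c c' : U) (x : ℕ → U) : splice N c c' x (N + 1) = c' := by
  simp [splice]

lemma Valid.congr {x y : ℕ → U} {n : ℕ} (h : κ.Valid B N x n) (hxy : ∀ m < n, x m = y m) :
    κ.Valid B N y n := by
  have hr : ∀ j ≤ n, res (κ.proj N y) j = res (κ.proj N x) j := fun j hj =>
    res_congr fun m hm => proj_congr (hxy m (by omega)).symm
  refine ⟨?_, fun hn => ?_, fun hn => ?_, fun hn => ?_, fun hn u hu => ?_, fun hn hu j h1 h2 => ?_⟩
  · rw [hr n le_rfl]; exact h.mem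
  · rw [← hxy N hn]; exact h.code hn
  · rw [← hxy N hn, hr _ (by omega)]; exact h.sig hn
  · rw [← hxy _ hn]; exact h.code' hn
  · rw [← hxy _ hn] at hu
    obtain ⟨h1, h2, h3, h4⟩ := h.acc hn u hu
    rw [← hxy N (by omega)]
    exact ⟨h1, h2, h3, fun j hj hju => (proj_congr (hxy j hj).symm).trans (h4 j hj hju)⟩
  · rw [← hxy _ hn] at hu
    rw [← hxy N (by omega), hr j h2]
    exact h.rej hn hu j h1 h2

lemma Valid.mono (hT : IsGameTree T) {x : ℕ → U} {m n : ℕ} (hmn : m ≤ n)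
    (h : κ.Valid B N x n) : κ.Valid B N x m where
  mem := mem_of_le hT hmn h.mem
  code hm := h.code (by omega)
  sig hm := h.sig (by omega)
  code' hm := h.code' (by omega)
  acc hm u hu := by
    obtain ⟨h1, h2, h3, h4⟩ := h.acc (by omega) u hu
    exact ⟨h1, h2, h3, fun j hj => h4 j (by omega)⟩
  rej hm hu j h1 h2 := h.rej (by omega) hu j h1 (by omega)

lemma res_mem_tree {x : ℕ → U} {n : ℕ} : res x n ∈ κ.tree B N ↔ κ.Valid B N x n := by
  have : ∀ m < n, seq (res x n) m = x m := fun m hm => seq_res hm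
  unfold tree
  rw [Set.mem_ofPred_eq, PiNat.res_length]
  exact ⟨fun h => h.congr this, fun h => h.congr fun m hm => (this m hm).symm⟩

lemma projPos_res (x : ℕ → U) (n : ℕ) : κ.projPos N (res x n) = res (κ.proj N x) n := by
  unfold projPos
  rw [PiNat.res_length]
  exact res_congr fun m hm => proj_congr (seq_res hm)

lemma valid_of_le {x : ℕ → U} {n : ℕ} (hn : n ≤ N) : κ.Valid B N x n ↔ res x n ∈ T := by
  have : res (κ.proj N x) n = res x n := res_congr fun m hm => proj_of_lt (by omega)
  rw [← this]
  exact ⟨fun h => h.mem, fun h => ⟨h, by omega, by omega, by omega, by omega, by omega⟩⟩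

/-- Every position of `B` extended by a move of `T` is in `B`. -/
def _root_.BorelGame.UpClosed (T B : Set (List U)) : Prop := ∀ a h, a :: h ∈ T → h ∈ B → a :: h ∈ B

omit [Inhabited U] in
lemma mem_up (hT : IsGameTree T) (hB : UpClosed T B) {x : ℕ → U} {m n : ℕ} (hmn : m ≤ n)
    (h : res x m ∈ B) (hx : res x n ∈ T) : res x n ∈ B := by
  induction n, hmn using Nat.le_induction with
  | base => exact h
  | succ n hmn ih => exact hB _ _ hx (ih (hT.tail _ _ hx))

omit [Inhabited U] in
lemma sig_subset (c : U) : κ.Sig c ⊆ T := (isSafe_safe _ _ _).sub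

omit [Inhabited U] in
lemma rej_subset (c : U) : κ.Rej B c ⊆ κ.Sig c := (isSafe_safe _ _ _).sub

/-- Extend a valid position. -/
lemma Valid.update {x : ℕ → U} {n : ℕ} (h : κ.Valid B N x n) {a : U} (hn : N + 2 ≤ n)
    (hT : a :: res (κ.proj N x) n ∈ T)
    (hacc : ∀ u, κ.O (x (N + 1)) = some u → n < u.length → a = seq u n)
    (hrej : κ.O (x (N + 1)) = none → a :: res (κ.proj N x) n ∈ κ.Rej B (x N)) :
    κ.Valid B N (Function.update x n a) (n + 1) := by
  set y := Function.update x n a with hy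
  have hv : κ.Valid B N y n := h.congr fun m hm => by rw [hy, Function.update_of_ne hm.ne]
  have hyn : κ.proj N y n = a := by rw [proj_of_ge hn, hy, Function.update_self]
  have hres : res (κ.proj N y) (n + 1) = a :: res (κ.proj N x) n := by
    rw [PiNat.res_succ, hyn]
    congr 1
    exact res_congr fun m hm => proj_congr (by rw [hy, Function.update_of_ne hm.ne])
  have hN : y N = x N := by rw [hy, Function.update_of_ne (by omega)]
  have hN' : y (N + 1) = x (N + 1) := by rw [hy, Function.update_of_ne (by omega)]
  refine ⟨?_, fun _ => hv.code (by omega), fun _ => hv.sig (by omega), fun _ => hv.code' (by omega),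
    fun _ u hu => ?_, fun _ hu j h1 h2 => ?_⟩
  · rwa [hres]
  · obtain ⟨h1, h2, h3, h4⟩ := hv.acc (by omega) u hu
    refine ⟨h1, h2, h3, fun j hj hju => ?_⟩
    rcases eq_or_ne j n with rfl | hne
    · rw [hyn]
      exact hacc u (by rwa [← hN']) hju
    · exact h4 j (by omega) hju
  · rcases eq_or_ne j (n + 1) with rfl | hne
    · rw [hres, hN]
      exact hrej (by rwa [← hN'])
    · exact hv.rej (by omega) hu j h1 (by omega)

lemma valid_splice {x : ℕ → U} {n : ℕ} {c c' : U} (hmem : res x n ∈ T) (hc : κ.mv c = x N)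
    (hc' : κ.mv c' = x (N + 1)) (hC : c ∈ κ.C) (hC' : c' ∈ κ.C)
    (hsig : res x (N + 1) ∈ κ.Sig c)
    (hacc : ∀ u, κ.O c' = some u → u ∈ B ∧ u ∈ κ.Sig c ∧ N + 2 ≤ u.length ∧
      ∀ j < n, j < u.length → x j = seq u j)
    (hrej : κ.O c' = none → ∀ j, N + 2 ≤ j → j ≤ n → res x j ∈ κ.Rej B c) :
    κ.Valid B N (splice N c c' x) n := by
  refine ⟨?_, fun _ => ?_, fun _ => ?_, fun _ => ?_, fun _ => ?_, fun _ => ?_⟩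
  all_goals try rw [proj_splice hc hc']
  all_goals try simp only [splice_self, splice_succ]
  all_goals assumption

lemma valid_code {x : ℕ → U} (hC : x N ∈ κ.C) (h : κ.mv (x N) :: res x N ∈ κ.Sig (x N)) :
    κ.Valid B N x (N + 1) := by
  have hres : res (κ.proj N x) (N + 1) = κ.mv (x N) :: res x N := by
    rw [PiNat.res_succ, proj, if_pos (Or.inl rfl)]
    congr 1
    exact res_congr fun m hm => proj_of_lt hm
  refine ⟨?_, fun _ => hC, fun _ => ?_, by omega, by omega, by omega⟩
  · rw [hres]
    exact sig_subset _ h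
  · rwa [hres]

lemma valid_answer {x : ℕ → U} (h : κ.Valid B N x (N + 1)) (hC : x (N + 1) ∈ κ.C)
    (hT : κ.mv (x (N + 1)) :: res (κ.proj N x) (N + 1) ∈ T)
    (hacc : ∀ u, κ.O (x (N + 1)) = some u → u ∈ B ∧ u ∈ κ.Sig (x N) ∧ N + 2 ≤ u.length ∧
      ∀ j < N + 2, κ.proj N x j = seq u j)
    (hrej : κ.O (x (N + 1)) = none →
      κ.mv (x (N + 1)) :: res (κ.proj N x) (N + 1) ∈ κ.Rej B (x N)) :
    κ.Valid B N x (N + 2) := by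
  have hres : res (κ.proj N x) (N + 2) = κ.mv (x (N + 1)) :: res (κ.proj N x) (N + 1) := by
    rw [PiNat.res_succ, proj, if_pos (Or.inr rfl)]
  refine ⟨?_, fun _ => h.code (by omega), fun _ => h.sig (by omega), fun _ => hC,
    fun _ u hu => ?_, fun _ hu j h1 h2 => ?_⟩
  · rwa [hres]
  · obtain ⟨h1, h2, h3, h4⟩ := hacc u hu
    exact ⟨h1, h2, h3, fun j hj _ => h4 j hj⟩
  · obtain rfl : j = N + 2 := by omega
    rw [hres]
    exact hrej hu

lemma Valid.exists_succ (hT : IsGameTree T) (hN : N % 2 = 0) {x : ℕ → U}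
    {n : ℕ} (h : κ.Valid B N x n) : ∃ a, κ.Valid B N (Function.update x n a) (n + 1) := by
  obtain ⟨a, ha⟩ := hT.ext _ h.mem
  have hsafe : ∀ c, IsSafe 0 T (κ.W c) (κ.Sig c) := fun c => isSafe_safe _ _ _
  have hrsafe : ∀ c, IsSafe 1 (κ.Sig c) B (κ.Rej B c) := fun c => isSafe_safe _ _ _
  rcases lt_trichotomy n N with hn | rfl | hn
  · rw [valid_of_le hn.le] at h
    obtain ⟨a, ha⟩ := hT.ext _ h
    refine ⟨a, (valid_of_le hn).2 ?_⟩
    rwa [← cons_res]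
  · rw [valid_of_le le_rfl] at h
    obtain ⟨a, ha⟩ := hT.ext _ h
    obtain ⟨h1, h2, h3, -⟩ := κ.ok a _ ∅ none ha (Set.empty_subset _) (by simp)
    refine ⟨κ.K a ∅ none, valid_code (by simpa) ?_⟩
    rw [Function.update_self, Sig, h3, h2, eq_safe_empty hT,
      res_congr (y := x) fun m hm => Function.update_of_ne hm.ne _ _]
    exact ha
  rcases Nat.lt_or_ge (N + 1) n with hn' | hn'
  · rcases hu : κ.O (x (N + 1)) with _ | u
    · have hR := h.rej hn' hu n (by omega) le_rfl
      obtain ⟨a, ha⟩ : ∃ a, a :: res (κ.proj N x) n ∈ κ.Rej B (x N) := by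
        by_cases hp : n % 2 = 1
        · exact (hrsafe _).own _ hR (by simpa using hp)
        · obtain ⟨a, ha⟩ := (hsafe _).own _ (rej_subset _ hR) (by rw [PiNat.res_length]; omega)
          exact ⟨a, (hrsafe _).opp _ hR (by simpa using hp) a ha⟩
      exact ⟨a, h.update (by omega) (sig_subset _ (rej_subset _ ha)) (by simp [hu]) fun _ => ha⟩
    · obtain ⟨h1, h2, h3, h4⟩ := h.acc hn' u hu
      by_cases hlen : n < u.length
      · refine ⟨seq u n, h.update (by omega) ?_ (fun v hv _ => by simp_all) (by simp [hu])⟩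
        have : res (κ.proj N x) n = res (seq u) n :=
          res_congr fun m hm => h4 m hm (by omega)
        rw [this, ← PiNat.res_succ]
        refine mem_of_le hT hlen ?_
        rw [res_seq]
        exact sig_subset _ h2
      · refine ⟨a, h.update (by omega) ha (fun v hv hlv => ?_) (by simp [hu])⟩
        obtain rfl : u = v := by simpa [hu] using hv
        omega
  · obtain rfl : n = N + 1 := by omega
    have hsig := h.sig (by omega)
    have key : ∀ c', c' ∈ κ.C → κ.mv c' :: res (κ.proj N x) (N + 1) ∈ T →
        (∀ u, κ.O c' = some u → u ∈ B ∧ u ∈ κ.Sig (x N) ∧ N + 2 ≤ u.length ∧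
          (∀ j < N + 1, κ.proj N x j = seq u j) ∧ κ.mv c' = seq u (N + 1)) →
        (κ.O c' = none → κ.mv c' :: res (κ.proj N x) (N + 1) ∈ κ.Rej B (x N)) →
        κ.Valid B N (Function.update x (N + 1) c') (N + 2) := by
      intro c' hC hm hacc hrej
      have hne : ∀ m < N + 1, Function.update x (N + 1) c' m = x m :=
        fun m hm => Function.update_of_ne hm.ne _ _
      have hx : res (κ.proj N (Function.update x (N + 1) c')) (N + 1) =
          res (κ.proj N x) (N + 1) := res_congr fun m hm => proj_congr (hne m hm)
      refine valid_answer (h.congr fun m hm => (hne m hm).symm) (by simpa) ?_ ?_ ?_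
      · rw [hx, Function.update_self]
        exact hm
      · intro u hu
        rw [Function.update_self] at hu
        obtain ⟨h1, h2, h3, h4, h5⟩ := hacc u hu
        rw [hne N (by omega)]
        refine ⟨h1, h2, h3, fun j hj => ?_⟩
        rcases eq_or_ne j (N + 1) with rfl | hjn
        · rw [proj, if_pos (Or.inr rfl), Function.update_self, h5]
        · rw [proj_congr (hne j (by omega)), h4 j (by omega)]
      · rw [hx, Function.update_self, hne N (by omega)]
        exact hrej
    by_cases hex : ∃ u, u ∈ B ∧ u ∈ κ.Sig (x N) ∧ N + 2 ≤ u.length ∧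
        ∀ j < N + 1, κ.proj N x j = seq u j
    · obtain ⟨u, h1, h2, h3, h4⟩ := hex
      have hmem : seq u (N + 1) :: res (κ.proj N x) (N + 1) ∈ T := by
        rw [res_congr h4, ← PiNat.res_succ]
        refine mem_of_le hT h3 ?_
        rw [res_seq]
        exact sig_subset _ h2
      obtain ⟨k1, k2, -, k4⟩ := κ.ok _ _ ∅ (some u) hmem (Set.empty_subset _)
        (by simpa using sig_subset _ h2)
      refine ⟨_, key _ k1 (by rwa [k2]) (fun v hv => ?_) (by simp [k4])⟩
      obtain rfl : u = v := by simpa [k4] using hv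
      exact ⟨h1, h2, h3, h4, k2⟩
    · push Not at hex
      obtain ⟨k1, k2, -, k4⟩ := κ.ok _ _ ∅ none ha (Set.empty_subset _) (by simp)
      have hodd : ∀ b, b :: res (κ.proj N x) (N + 1) ∈ T →
          b :: res (κ.proj N x) (N + 1) ∈ κ.Sig (x N) :=
        fun b hb => (hsafe _).opp _ hsig (by rw [PiNat.res_length]; omega) b hb
      refine ⟨_, key _ k1 (by rwa [k2]) (by simp [k4]) fun _ => ?_⟩
      rw [k2]
      refine ⟨{h | h ∈ κ.Sig (x N) ∧ N + 2 ≤ h.length ∧ ∀ j < N + 1, κ.proj N x j = seq h j},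
        ⟨fun h hh => hh.1, ?_, ?_, ?_⟩, hodd a ha, by simp, fun j hj => ?_⟩
      · rintro h ⟨h1, h2, h3⟩ hhB
        obtain ⟨j, hj, hne⟩ := hex h hhB h1 h2
        exact hne (h3 j hj)
      · rintro h ⟨h1, h2, h3⟩ hp
        obtain ⟨b, hb⟩ := hT.ext h (sig_subset _ h1)
        refine ⟨b, (hsafe _).opp _ h1 (by omega) b hb, by simp; omega, fun j hj => ?_⟩
        rw [h3 j hj, seq, if_neg (by omega)]
      · rintro h ⟨h1, h2, h3⟩ hp b hb
        refine ⟨hb, by simp; omega, fun j hj => ?_⟩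
        rw [h3 j hj, seq, if_neg (by omega)]
      · rw [cons_res, seq_res (by omega), Function.update_of_ne hj.ne]

theorem isGameTree_tree (hT : IsGameTree T) (hN : N % 2 = 0) :
    IsGameTree (κ.tree B N) where
  nil := (valid_of_le (Nat.zero_le N)).2 hT.nil
  tail a h hh := by
    rw [← res_seq h, cons_res, res_mem_tree] at hh
    rw [← res_seq h, res_mem_tree]
    exact (hh.mono hT (Nat.le_succ _)).congr fun m hm => Function.update_of_ne hm.ne _ _
  ext h hh := by
    rw [← res_seq h, res_mem_tree] at hh
    obtain ⟨a, ha⟩ := hh.exists_succ hT hN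
    exact ⟨a, by rw [← res_seq h, cons_res, res_mem_tree]; exact ha⟩

end Coding

/-- The set of stages between `N + 2` and `n` where `x` visits `Q`. -/
def hits (N : ℕ) (Q : Set (List U)) (x : ℕ → U) (n : ℕ) : Set ℕ :=
  {j | N + 2 ≤ j ∧ j ≤ n ∧ res x j ∈ Q}

lemma hits_congr {N : ℕ} {Q : Set (List U)} {x y : ℕ → U} {n : ℕ} (h : ∀ m < n, x m = y m) :
    hits N Q x n = hits N Q y n := by
  ext j
  simp only [hits, Set.mem_ofPred_eq]
  refine and_congr_right fun _ => and_congr_right fun h2 => ?_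
  rw [res_congr fun m hm => h m (hm.trans_le h2)]

lemma sInf_hits {N : ℕ} {Q : Set (List U)} {x : ℕ → U} {M n : ℕ} (hM : N + 2 ≤ M)
    (hQ : res x M ∈ Q) (hmin : ∀ j, N + 2 ≤ j → j < M → res x j ∉ Q) (hn : M ≤ n) :
    sInf (hits N Q x n) = M := by
  refine le_antisymm (Nat.sInf_le ⟨hM, hn, hQ⟩) (le_csInf ⟨M, hM, hn, hQ⟩ ?_)
  rintro j ⟨h1, -, h3⟩
  by_contra hj
  exact hmin j h1 (by omega) h3

lemma exists_first {N : ℕ} {Q : Set (List U)} {x : ℕ → U} (h : ∃ j, N + 2 ≤ j ∧ res x j ∈ Q) :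
    ∃ M, N + 2 ≤ M ∧ res x M ∈ Q ∧ ∀ j, N + 2 ≤ j → j < M → res x j ∉ Q := by
  classical
  refine ⟨Nat.find h, (Nat.find_spec h).1, (Nat.find_spec h).2, fun j h1 h2 h3 => ?_⟩
  exact Nat.find_min h h2 ⟨h1, h3⟩

lemma splice_congr {N : ℕ} {c c' : U} {x y : ℕ → U} {n : ℕ} (h : ∀ m < n, x m = y m) :
    res (splice N c c' x) n = res (splice N c c' y) n :=
  res_congr fun m hm => by simp only [splice, h m hm]

/-- From stage `m` to stage `n` the play `x` stays in `Q`. -/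
def Stays (Q : Set (List U)) (m n : ℕ) (x : ℕ → U) : Prop := ∀ j, m ≤ j → j ≤ n → res x j ∈ Q

lemma stays_congr {Q : Set (List U)} {x y : ℕ → U} {m n : ℕ} (h : ∀ m < n, x m = y m) :
    Stays Q m n x = Stays Q m n y :=
  propext <| forall_congr' fun _ => forall_congr' fun _ => forall_congr' fun hj => by
    rw [res_congr fun m hm => h m (hm.trans_le hj)]

namespace Coding

variable [Inhabited U] {T : Set (List U)} (κ : Coding T) (B : Set (List U)) (N : ℕ)

/-- A positional strategy by which player `0` reaches `B` inside `κ.Sig c`. -/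
noncomputable def reachB (c : U) : List U → U := (exists_reach 1 (κ.Sig c) B).choose

/-- A positional strategy by which player `1` reaches `Q` inside `T`. -/
noncomputable def reachT (T Q : Set (List U)) : List U → U := (exists_reach 0 T Q).choose

open Classical in
/-- The move of player `0` after the play `x` has gone through `n` moves. -/
noncomputable def move₀ (s : List U → U) (x : ℕ → U) (n : ℕ) : U :=
  let c := s (res x N)
  if n = N then κ.mv c
  else if (hits N B x n).Nonempty then
    s (res (splice N c (κ.K (x (N + 1)) ∅ (some (res x (sInf (hits N B x n))))) x) n)
  else if Stays (κ.Rej B c) (N + 2) n x then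
    s (res (splice N c (κ.K (x (N + 1)) ∅ none) x) n)
  else κ.reachB B c (res x n)

/-- The move `c` leads player `1` following `s` to name `u`. -/
def Leads (s : List U → U) (g u : List U) (c : U) : Prop :=
  c :: g ∈ κ.tree B N ∧ κ.O (s (c :: g)) = some u

/-- The positions player `1` may name following `s` after player `0` moves `a` at `g`. -/
def targets (s : List U → U) (g : List U) (a : U) : Set (List U) :=
  {u | ∃ c, κ.mv c = a ∧ κ.Leads B N s g u c}

/-- A move with projection `a` that leads player `1` following `s` to name `u`. -/
noncomputable def witness (s : List U → U) (g : List U) (a : U) (u : List U) : U :=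
  Classical.epsilon fun c => κ.mv c = a ∧ κ.Leads B N s g u c

open Classical in
/-- The move of player `1` after the play `x` has gone through `n` moves. -/
noncomputable def move₁ (s : List U → U) (x : ℕ → U) (n : ℕ) : U :=
  let Q := κ.targets B N s (res x N) (x N)
  if (hits N Q x n).Nonempty then
    let c := κ.witness B N s (res x N) (x N) (res x (sInf (hits N Q x n)))
    s (res (splice N c (s (c :: res x N)) x) n)
  else if Stays (Safe 0 T Q) (N + 1) n x then
    let c := κ.K (x N) Q none
    if n = N + 1 then κ.mv (s (c :: res x N)) else s (res (splice N c (s (c :: res x N)) x) n)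
  else reachT T Q (res x n)

open Classical in
/-- Transfer a strategy from the auxiliary game. -/
noncomputable def str (p : ℕ) (s : List U → U) (h : List U) : U :=
  if h.length < N + p then s h
  else legalize T (fun h => if p = 0 then κ.move₀ B N s (seq h) h.length else
    κ.move₁ B N s (seq h) h.length) h

variable {κ B N}

lemma move₀_congr {s s' : List U → U} {x y : ℕ → U} {n : ℕ} (hn : N ≤ n)
    (hs : ∀ h : List U, h.length ≤ n → s h = s' h) (hxy : ∀ m < n, x m = y m) :
    κ.move₀ B N s x n = κ.move₀ B N s' y n := by
  have hr : ∀ j ≤ n, res x j = res y j := fun j hj => res_congr fun m hm => hxy m (by omega)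
  have hs' : ∀ x : ℕ → U, s (res x n) = s' (res x n) := fun x => hs _ (by rw [PiNat.res_length])
  have hc : s (res x N) = s' (res y N) := by
    rw [← hr N hn]
    exact hs _ (by rwa [PiNat.res_length])
  unfold move₀
  dsimp only
  rw [hc, hits_congr hxy, stays_congr hxy]
  simp only [hs', splice_congr hxy, hr n le_rfl]
  split_ifs with h2 h3 h4
  · rfl
  · have h5 := Nat.sInf_mem h3
    rw [hr _ h5.2.1, hxy (N + 1) (by have := h5.1; have := h5.2.1; omega)]
  · rcases Nat.lt_or_ge (N + 1) n with h6 | h6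
    · rw [hxy (N + 1) h6]
    · congr 1
      exact res_congr fun m hm => by simp only [splice, show m ≠ N + 1 by omega, if_false]
  · rfl

lemma move₁_congr {s s' : List U → U} {x y : ℕ → U} {n : ℕ} (hn : N < n)
    (hs : ∀ h : List U, h.length ≤ n → s h = s' h) (hxy : ∀ m < n, x m = y m) :
    κ.move₁ B N s x n = κ.move₁ B N s' y n := by
  have hr : ∀ j ≤ n, res x j = res y j := fun j hj => res_congr fun m hm => hxy m (by omega)
  have hs' : ∀ x : ℕ → U, s (res x n) = s' (res x n) := fun x => hs _ (by rw [PiNat.res_length])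
  have hs'' : ∀ c, s (c :: res y N) = s' (c :: res y N) :=
    fun c => hs _ (by rw [List.length_cons, PiNat.res_length]; exact hn)
  have hL : κ.Leads B N s (res y N) = κ.Leads B N s' (res y N) := by
    funext u c
    rw [Leads, Leads, hs'']
  have hQ : κ.targets B N s (res x N) (x N) = κ.targets B N s' (res y N) (y N) := by
    rw [hr N hn.le, hxy N hn, targets, targets, hL]
  have hW : κ.witness B N s (res x N) (x N) = κ.witness B N s' (res y N) (y N) := by
    funext u
    rw [hr N hn.le, hxy N hn, witness, witness, hL]
  unfold move₁
  dsimp only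
  rw [hQ, hW]
  set Q := κ.targets B N s' (res y N) (y N)
  rw [hits_congr hxy, stays_congr hxy]
  simp only [hs', splice_congr hxy, hr n le_rfl, hr N hn.le, hs'', hxy N hn]
  split_ifs with h2
  · rw [hr _ (Nat.sInf_mem h2).2.1]
  all_goals rfl

lemma str_of_lt {p : ℕ} {s : List U → U} {h : List U} (hh : h.length < N + p) :
    κ.str B N p s h = s h := if_pos hh

lemma str_zero {s : List U → U} {x : ℕ → U} {n : ℕ} (hn : N ≤ n)
    (hT : κ.move₀ B N s x n :: res x n ∈ T) : κ.str B N 0 s (res x n) = κ.move₀ B N s x n := by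
  have : κ.move₀ B N s (seq (res x n)) n = κ.move₀ B N s x n :=
    move₀_congr hn (fun _ _ => rfl) fun m hm => seq_res hm
  rw [str, if_neg (by rw [PiNat.res_length]; omega), legalize_eq] <;>
    simp only [PiNat.res_length, if_true, this]
  exact hT

lemma str_one {s : List U → U} {x : ℕ → U} {n : ℕ} (hn : N < n)
    (hT : κ.move₁ B N s x n :: res x n ∈ T) : κ.str B N 1 s (res x n) = κ.move₁ B N s x n := by
  have : κ.move₁ B N s (seq (res x n)) n = κ.move₁ B N s x n :=
    move₁_congr hn (fun _ _ => rfl) fun m hm => seq_res hm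
  rw [str, if_neg (by rw [PiNat.res_length]; omega), legalize_eq] <;>
    simp only [PiNat.res_length, one_ne_zero, if_false, this]
  exact hT

lemma str_loc {p : ℕ} (hp : p < 2) {n : ℕ} {s s' : List U → U}
    (hs : ∀ h : List U, h.length ≤ n → s h = s' h) (h : List U) (hh : h.length ≤ n) :
    κ.str B N p s h = κ.str B N p s' h := by
  unfold str
  have hs' : ∀ g : List U, g.length ≤ h.length → s g = s' g := fun g hg => hs g (by omega)
  split_ifs with h1 h2
  · exact hs h hh
  · exact legalize_congr (fun _ => Iff.rfl) (move₀_congr (by omega) hs' fun _ _ => rfl)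
  · exact legalize_congr (fun _ => Iff.rfl) (move₁_congr (by omega) hs' fun _ _ => rfl)

/-- A legal move in the auxiliary game projects to a legal move. -/
lemma legal_proj {p : ℕ} {s : List U → U} (hs : Legal p (κ.tree B N) s) {x : ℕ → U} {n : ℕ}
    (h : κ.Valid B N x n) (hn : n % 2 = p) :
    κ.Valid B N (Function.update x n (s (res x n))) (n + 1) := by
  rw [← res_mem_tree, ← cons_res]
  exact hs _ (res_mem_tree.2 h) (by rwa [PiNat.res_length])

lemma Valid.cons_mem {x : ℕ → U} {n : ℕ} {a : U} (h : κ.Valid B N (Function.update x n a) (n + 1))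
    (hn : N + 2 ≤ n) : a :: res (κ.proj N x) n ∈ T := by
  have := h.mem
  rw [PiNat.res_succ, proj_of_ge hn, Function.update_self] at this
  rwa [res_congr (y := κ.proj N x) fun m hm => proj_congr (Function.update_of_ne hm.ne _ _)] at this

lemma Valid.eq_of_acc {x : ℕ → U} {n : ℕ} {a : U}
    (h : κ.Valid B N (Function.update x n a) (n + 1)) (hn : N + 2 ≤ n) {u : List U}
    (hu : κ.O (x (N + 1)) = some u) (hlen : n < u.length) : a = seq u n := by
  have h1 : Function.update x n a (N + 1) = x (N + 1) := Function.update_of_ne (by omega) _ _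
  rw [← h1] at hu
  have := (h.acc (by omega) u hu).2.2.2 n (by omega) hlen
  rwa [proj_of_ge hn, Function.update_self] at this

lemma Valid.cons_rej {x : ℕ → U} {n : ℕ} {a : U}
    (h : κ.Valid B N (Function.update x n a) (n + 1)) (hn : N + 2 ≤ n)
    (hu : κ.O (x (N + 1)) = none) : a :: res (κ.proj N x) n ∈ κ.Rej B (x N) := by
  have h1 : Function.update x n a (N + 1) = x (N + 1) := Function.update_of_ne (by omega) _ _
  have h2 : Function.update x n a N = x N := Function.update_of_ne (by omega) _ _
  rw [← h1] at hu
  have := h.rej (by omega) hu (n + 1) (by omega) le_rfl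
  rw [PiNat.res_succ, proj_of_ge hn, Function.update_self, h2] at this
  rwa [res_congr (y := κ.proj N x) fun m hm => proj_congr (Function.update_of_ne hm.ne _ _)] at this

end Coding

lemma hits_empty {N : ℕ} {Q : Set (List U)} {x : ℕ → U} {n : ℕ}
    (h : ∀ j, N + 2 ≤ j → j ≤ n → res x j ∉ Q) : ¬ (hits N Q x n).Nonempty := by
  rintro ⟨j, h1, h2, h3⟩
  exact h j h1 h2 h3

namespace Coding

variable [Inhabited U] {T : Set (List U)} {κ : Coding T} {B : Set (List U)} {N : ℕ}

/-- A play against a transferred strategy of player `1` or `0` passing through a position `u`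
named in the auxiliary game. -/
lemma splice_acc {x : ℕ → U} (hx : x ∈ plays T) {c c' : U} {M : ℕ}
    (hc : κ.mv c = x N) (hc' : κ.mv c' = x (N + 1)) (hC : c ∈ κ.C) (hC' : c' ∈ κ.C)
    (hsig : res x (N + 1) ∈ κ.Sig c) (hM : N + 2 ≤ M) (hB : res x M ∈ B)
    (hS : res x M ∈ κ.Sig c) (hO : κ.O c' = some (res x M)) :
    splice N c c' x ∈ plays (κ.tree B N) := fun n => by
  rw [res_mem_tree]
  refine valid_splice (hx n) hc hc' hC hC' hsig (fun u hu => ?_) (by simp [hO])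
  obtain rfl : res x M = u := by simpa [hO] using hu
  refine ⟨hB, hS, by rwa [PiNat.res_length], fun j _ hj => ?_⟩
  rw [PiNat.res_length] at hj
  rw [seq_res hj]

/-- Before reaching the named position, a legal strategy follows it. -/
lemma eq_of_acc {p : ℕ} {s : List U → U} (hs : Legal p (κ.tree B N) s) {x : ℕ → U} {c c' : U}
    {M n : ℕ} (hv : κ.Valid B N (splice N c c' x) n) (hO : κ.O c' = some (res x M)) (hn : N + 2 ≤ n)
    (hnM : n < M) (hp : n % 2 = p) : splice N c c' x n = s (res (splice N c c' x) n) := by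
  rw [(legal_proj hs hv hp).eq_of_acc hn (u := res x M) (by simp [hO]) (by simpa), seq_res hnM,
    splice_ge hn]

omit [Inhabited U] in
lemma splice_res_of_le {c c' : U} {x : ℕ → U} {n : ℕ} (hn : n ≤ N) :
    res (splice N c c' x) n = res x n :=
  res_congr fun m hm => splice_lt (by omega)

theorem lift_zero (hN : N % 2 = 0) {s : List U → U}
    (hs : Legal 0 (κ.tree B N) s) {x : ℕ → U} (hx : x ∈ plays T)
    (hf : Follows 0 (κ.str B N 0 s) x) :
    ∃ c c', κ.mv c = x N ∧ κ.mv c' = x (N + 1) ∧ splice N c c' x ∈ plays (κ.tree B N) ∧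
      Follows 0 s (splice N c c' x) := by
  obtain ⟨c, hcdef⟩ : ∃ c, c = s (res x N) := ⟨_, rfl⟩
  have hsafe : IsSafe 0 T (κ.W c) (κ.Sig c) := isSafe_safe _ _ _
  have hrsafe : IsSafe 1 (κ.Sig c) B (κ.Rej B c) := isSafe_safe _ _ _
  have hmove : ∀ n, N ≤ n → n % 2 = 0 → κ.move₀ B N s x n :: res x n ∈ T →
      x n = κ.move₀ B N s x n := fun n h1 h2 h3 => by rw [hf n h2, str_zero h1 h3]
  -- the move at stage `N`
  have hvc : κ.Valid B N (Function.update x N c) (N + 1) := by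
    rw [hcdef]
    exact legal_proj hs ((valid_of_le le_rfl).2 (hx N)) hN
  have hC : c ∈ κ.C := by simpa using hvc.code (by omega)
  have hsig' : κ.mv c :: res x N ∈ κ.Sig c := by
    have := hvc.sig (by omega)
    rw [PiNat.res_succ, proj, if_pos (Or.inl rfl), Function.update_self,
      res_congr (y := x) fun m hm => ?_] at this
    · exact this
    · rw [proj_of_lt hm, Function.update_of_ne hm.ne]
  have hmN : κ.move₀ B N s x N = κ.mv c := by rw [move₀, if_pos rfl, hcdef]
  have hc : κ.mv c = x N := by
    rw [hmove N le_rfl hN (by rw [hmN]; exact sig_subset _ hsig'), hmN]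
  have hsig : res x (N + 1) ∈ κ.Sig c := by rw [PiNat.res_succ, ← hc]; exact hsig'
  have hKn := κ.ok (x (N + 1)) (res x (N + 1)) ∅ none (hx (N + 2)) (Set.empty_subset _) (by simp)
  obtain ⟨c₀, hc₀⟩ : ∃ c₀, c₀ = κ.K (x (N + 1)) ∅ none := ⟨_, rfl⟩
  rw [← hc₀] at hKn
  have hvalid_rej : ∀ n, Stays (κ.Rej B c) (N + 2) n x → κ.Valid B N (splice N c c₀ x) n :=
    fun n hn => valid_splice (hx n) hc hKn.2.1 hC hKn.1 hsig (by simp [hKn.2.2.2])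
      fun _ j h1 h2 => hn j h1 h2
  -- moves while the play stays outside of `B`
  have hrejmove : ∀ n, N + 2 ≤ n → n % 2 = 0 → (∀ j, N + 2 ≤ j → j ≤ n → res x j ∉ B) →
      Stays (κ.Rej B c) (N + 2) n x →
      x n = s (res (splice N c c₀ x) n) ∧ x n :: res x n ∈ κ.Rej B c := by
    intro n hn hp hB hst
    have hm : κ.move₀ B N s x n = s (res (splice N c c₀ x) n) := by
      rw [move₀, ← hcdef]
      rw [if_neg (by omega), if_neg (hits_empty hB), if_pos hst, hc₀]
    have h1 := legal_proj hs (hvalid_rej n hst) hp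
    have h2 := h1.cons_rej hn (by simp [hKn.2.2.2])
    rw [proj_splice hc hKn.2.1, splice_self] at h2
    have h3 := hmove n (by omega) hp (by rw [hm]; exact sig_subset _ (rej_subset _ h2))
    rw [h3, hm]
    exact ⟨rfl, h2⟩
  have hreachmove : ∀ n, N + 2 ≤ n → n % 2 = 0 → (∀ j, N + 2 ≤ j → j ≤ n → res x j ∉ B) →
      ¬ Stays (κ.Rej B c) (N + 2) n x → res x n ∈ κ.Sig c →
      x n = κ.reachB B c (res x n) ∧ x n :: res x n ∈ κ.Sig c := by
    intro n hn hp hB hst hS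
    have hm : κ.move₀ B N s x n = κ.reachB B c (res x n) := by
      rw [move₀, ← hcdef]
      rw [if_neg (by omega), if_neg (hits_empty hB), if_neg hst]
    have h2 : κ.reachB B c (res x n) :: res x n ∈ κ.Sig c :=
      (exists_reach 1 (κ.Sig c) B).choose_spec.1 _ (hsafe.own _ hS (by rwa [PiNat.res_length]))
    have h3 := hmove n (by omega) hp (by rw [hm]; exact sig_subset _ h2)
    rw [h3, hm]
    exact ⟨rfl, h2⟩
  have hinsig : ∀ m, N + 1 ≤ m → (∀ j, N + 2 ≤ j → j < m → res x j ∉ B) → res x m ∈ κ.Sig c := by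
    intro m hm
    induction m, hm using Nat.le_induction with
    | base => exact fun _ => hsig
    | succ m hm ih =>
      intro hB
      have hS := ih fun j h1 h2 => hB j h1 (by omega)
      by_cases hp : m % 2 = 0
      · have hB' : ∀ j, N + 2 ≤ j → j ≤ m → res x j ∉ B := fun j h1 h2 => hB j h1 (by omega)
        by_cases hst : Stays (κ.Rej B c) (N + 2) m x
        · exact rej_subset _ (hrejmove m (by omega) hp hB' hst).2
        · exact (hreachmove m (by omega) hp hB' hst hS).2
      · exact hsafe.opp _ hS (by rwa [PiNat.res_length]) _ (hx (m + 1))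
  by_cases hit : ∃ j, N + 2 ≤ j ∧ res x j ∈ B
  · obtain ⟨M, hM, hMB, hmin⟩ := exists_first hit
    have hMS : res x M ∈ κ.Sig c := hinsig M (by omega) hmin
    have hK := κ.ok (x (N + 1)) (res x (N + 1)) ∅ (some (res x M)) (hx (N + 2))
      (Set.empty_subset _) (by simpa using hx M)
    obtain ⟨c', hc'⟩ : ∃ c', c' = κ.K (x (N + 1)) ∅ (some (res x M)) := ⟨_, rfl⟩
    rw [← hc'] at hK
    have hplay := splice_acc hx hc hK.2.1 hC hK.1 hsig hM hMB hMS hK.2.2.2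
    refine ⟨c, c', hc, hK.2.1, hplay, fun n hp => ?_⟩
    rcases lt_trichotomy n N with hn | rfl | hn
    · rw [splice_lt hn, splice_res_of_le hn.le, hf n hp, str_of_lt (by simpa using hn)]
    · rw [splice_self, splice_res_of_le le_rfl, hcdef]
    · have hn2 : N + 2 ≤ n := by omega
      rcases lt_or_ge n M with hnM | hnM
      · exact eq_of_acc hs (res_mem_tree.1 (hplay n)) hK.2.2.2 hn2 hnM hp
      · have hm : κ.move₀ B N s x n = s (res (splice N c c' x) n) := by
          rw [move₀, ← hcdef]
          rw [if_neg (by omega), if_pos ⟨M, hM, hnM, hMB⟩, sInf_hits hM hMB hmin hnM, hc']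
        have h1 := (legal_proj hs (res_mem_tree.1 (hplay n)) hp).cons_mem hn2
        rw [proj_splice hc hK.2.1] at h1
        rw [splice_ge hn2, hmove n (by omega) hp (by rwa [hm]), hm]
  · push Not at hit
    have hall : ∀ n, N + 2 ≤ n → res x n ∈ κ.Rej B c := by
      intro n hn
      by_contra hcon
      obtain ⟨m, hm, hmB⟩ := (exists_reach 1 (κ.Sig c) B).choose_spec.2 x n
        (fun m hm => hinsig m (by omega) fun j h1 _ => hit j h1)
        (fun m hm hp => (hreachmove m (by omega) (by omega) (fun j h1 _ => hit j h1)
          (fun hst => hcon (hst n hn hm)) (hinsig m (by omega) fun j h1 _ => hit j h1)).1) hcon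
      exact hit m (by omega) hmB
    refine ⟨c, c₀, hc, hKn.2.1,
      fun n => res_mem_tree.2 (hvalid_rej n fun j h1 _ => hall j h1), fun n hp => ?_⟩
    rcases lt_trichotomy n N with hn | rfl | hn
    · rw [splice_lt hn, splice_res_of_le hn.le, hf n hp, str_of_lt (by simpa using hn)]
    · rw [splice_self, splice_res_of_le le_rfl, hcdef]
    · rw [splice_ge (by omega)]
      exact (hrejmove n (by omega) hp (fun j h1 _ => hit j h1) fun j h1 _ => hall j h1).1

omit [Inhabited U] in
lemma splice_res_succ (c c' : U) (x : ℕ → U) :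
    res (splice N c c' x) (N + 1) = c :: res x N := by
  rw [PiNat.res_succ, splice_self, splice_res_of_le le_rfl]

/-- The reply of a legal strategy of player `1` to the move `c` at stage `N`. -/
lemma reply_spec (hN : N % 2 = 0) {s : List U → U} (hs : Legal 1 (κ.tree B N) s) {x : ℕ → U}
    {c : U} (hc : κ.mv c = x N) (hv : c :: res x N ∈ κ.tree B N) :
    c ∈ κ.C ∧ res x (N + 1) ∈ κ.Sig c ∧ s (c :: res x N) ∈ κ.C ∧
    κ.mv (s (c :: res x N)) :: res x (N + 1) ∈ T ∧
    (∀ u, κ.O (s (c :: res x N)) = some u →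
      u ∈ B ∧ u ∈ κ.Sig c ∧ N + 2 ≤ u.length ∧ κ.mv (s (c :: res x N)) = seq u (N + 1)) ∧
    (κ.O (s (c :: res x N)) = none → κ.mv (s (c :: res x N)) :: res x (N + 1) ∈ κ.Rej B c) := by
  have h1 := hs _ hv (by rw [List.length_cons, PiNat.res_length]; omega)
  set r := s (c :: res x N)
  have h2 : r :: c :: res x N = res (splice N c r x) (N + 2) := by
    rw [PiNat.res_succ, splice_succ, splice_res_succ]
  rw [h2, res_mem_tree] at h1
  have hres : res (κ.proj N (splice N c r x)) (N + 1) = res x (N + 1) := by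
    refine res_congr fun m hm => ?_
    rcases eq_or_ne m N with rfl | hne
    · rw [proj, if_pos (Or.inl rfl), splice_self, hc]
    · rw [proj_of_lt (by omega), splice_lt (by omega)]
  have hr : κ.proj N (splice N c r x) (N + 1) = κ.mv r := by
    rw [proj, if_pos (Or.inr rfl), splice_succ]
  have hcode := h1.code (by omega)
  have hsig := h1.sig (by omega)
  have hcode' := h1.code' (by omega)
  have hmem := h1.mem
  have hacc := h1.acc (by omega)
  have hrej := h1.rej (by omega)
  rw [PiNat.res_succ] at hmem
  simp only [splice_self, splice_succ] at hcode hsig hcode' hacc hrej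
  rw [hres] at hsig hmem
  rw [hr] at hmem
  refine ⟨hcode, hsig, hcode', hmem, fun u hu => ?_, fun hu => ?_⟩
  · obtain ⟨h1, h2, h3, h4⟩ := hacc u hu
    exact ⟨h1, h2, h3, by rw [← hr, h4 (N + 1) (by omega) (by omega)]⟩
  · have := hrej hu (N + 2) le_rfl le_rfl
    rwa [PiNat.res_succ, hr, hres] at this

theorem lift_one (hN : N % 2 = 0) {s : List U → U}
    (hs : Legal 1 (κ.tree B N) s) {x : ℕ → U} (hx : x ∈ plays T)
    (hf : Follows 1 (κ.str B N 1 s) x) :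
    ∃ c c', κ.mv c = x N ∧ κ.mv c' = x (N + 1) ∧ splice N c c' x ∈ plays (κ.tree B N) ∧
      Follows 1 s (splice N c c' x) := by
  have hmove : ∀ n, N < n → n % 2 = 1 → κ.move₁ B N s x n :: res x n ∈ T →
      x n = κ.move₁ B N s x n := fun n h1 h2 h3 => by rw [hf n h2, str_one h1 h3]
  obtain ⟨Q, hQ⟩ : ∃ Q, Q = κ.targets B N s (res x N) (x N) := ⟨_, rfl⟩
  have hQspec : ∀ u ∈ Q, u ∈ T ∧ N + 2 ≤ u.length := by
    intro u hu
    rw [hQ] at hu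
    obtain ⟨c, hc, hv, hO⟩ := hu
    obtain ⟨-, -, -, -, h5, -⟩ := reply_spec hN hs hc hv
    exact ⟨sig_subset _ (h5 u hO).2.1, (h5 u hO).2.2.1⟩
  by_cases hit : ∃ j, N + 2 ≤ j ∧ res x j ∈ Q
  · obtain ⟨M, hM, hMQ, hmin⟩ := exists_first hit
    obtain ⟨c, hcdef⟩ : ∃ c, c = κ.witness B N s (res x N) (x N) (res x M) := ⟨_, rfl⟩
    have hcs : κ.mv c = x N ∧ κ.Leads B N s (res x N) (res x M) c := by
      rw [hcdef]
      rw [hQ] at hMQ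
      exact Classical.epsilon_spec hMQ
    obtain ⟨hc, hv, hO⟩ := hcs
    obtain ⟨hC, hsig, hC', -, h5, -⟩ := reply_spec hN hs hc hv
    obtain ⟨c', hc'⟩ : ∃ c', c' = s (c :: res x N) := ⟨_, rfl⟩
    rw [← hc'] at hO h5 hC'
    obtain ⟨hMB, hMS, -, hmv⟩ := h5 _ hO
    rw [seq_res (by omega)] at hmv
    have hplay := splice_acc hx hc hmv hC hC' hsig hM hMB hMS hO
    refine ⟨c, c', hc, hmv, hplay, fun n hp => ?_⟩
    rcases lt_or_ge n N with hn | hn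
    · rw [splice_lt hn, splice_res_of_le hn.le, hf n hp, str_of_lt (by rw [PiNat.res_length]; omega)]
    rcases eq_or_lt_of_le (show N + 1 ≤ n by omega) with rfl | hn2
    · rw [splice_succ, splice_res_succ, hc']
    rcases lt_or_ge n M with hnM | hnM
    · exact eq_of_acc hs (res_mem_tree.1 (hplay n)) hO hn2 hnM hp
    · have hm : κ.move₁ B N s x n = s (res (splice N c c' x) n) := by
        rw [move₁, ← hQ]
        dsimp only
        rw [if_pos ⟨M, hM, hnM, hMQ⟩, sInf_hits hM hMQ hmin hnM, ← hcdef, hc']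
      have h1 := (legal_proj hs (res_mem_tree.1 (hplay n)) hp).cons_mem hn2
      rw [proj_splice hc hmv] at h1
      rw [splice_ge hn2, hmove n (by omega) hp (by rwa [hm]), hm]
  · push Not at hit
    have hsafe : ∀ n, N + 1 ≤ n → res x n ∈ Safe 0 T Q := by
      intro n hn
      by_contra hcon
      have hfol : ∀ m ≥ n, m % 2 ≠ 0 → x m = reachT T Q (res x m) := fun m hm hp => by
        have hm1 : κ.move₁ B N s x m = reachT T Q (res x m) := by
          rw [move₁, ← hQ]
          dsimp only
          rw [if_neg (hits_empty fun j h1 _ => hit j h1), if_neg fun hst => hcon (hst n hn hm)]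
        have h2 : reachT T Q (res x m) :: res x m ∈ T :=
          (exists_reach 0 T Q).choose_spec.1 _ ⟨_, hx (m + 1)⟩
        rw [hmove m (by omega) (by omega) (by rwa [hm1]), hm1]
      obtain ⟨m, hm, hmQ⟩ := (exists_reach 0 T Q).choose_spec.2 x n (fun m _ => hx m) hfol hcon
      have := (hQspec _ hmQ).2
      rw [PiNat.res_length] at this
      exact hit m this hmQ
    obtain ⟨hC, hc, hW, -⟩ := κ.ok (x N) (res x N) Q none (hx (N + 1))
      (fun u hu => (hQspec u hu).1) (by simp)
    obtain ⟨c, hcdef⟩ : ∃ c, c = κ.K (x N) Q none := ⟨_, rfl⟩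
    rw [← hcdef] at hC hc hW
    have hSig : κ.Sig c = Safe 0 T Q := by rw [Sig, hW]
    have hv : c :: res x N ∈ κ.tree B N := by
      rw [← splice_res_succ c c x, res_mem_tree]
      refine valid_code (by simpa) ?_
      rw [splice_self, splice_res_of_le le_rfl, hc, hSig]
      exact hsafe (N + 1) le_rfl
    obtain ⟨-, hsig, hC', hmT, h5, h6⟩ := reply_spec hN hs hc hv
    have hO : κ.O (s (c :: res x N)) = none := by
      rcases hu : κ.O (s (c :: res x N)) with _ | u
      · rfl
      · refine absurd ?_ ((isSafe_safe 0 T Q).avoid u ?_)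
        · rw [hQ]
          exact ⟨c, hc, hv, hu⟩
        · rw [← hSig]
          exact (h5 u hu).2.1
    have h6 := h6 hO
    obtain ⟨c', hc'⟩ : ∃ c', c' = s (c :: res x N) := ⟨_, rfl⟩
    rw [← hc'] at hO h6 hC' hmT
    have hmv : κ.mv c' = x (N + 1) := by
      have hm : κ.move₁ B N s x (N + 1) = κ.mv c' := by
        rw [move₁, ← hQ]
        dsimp only
        rw [if_neg (hits_empty fun j h1 _ => hit j h1), if_pos (show Stays (Safe 0 T Q) (N + 1) _ x from fun j h1 _ => hsafe j h1),
          if_pos rfl, ← hcdef, ← hc']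
      rw [hmove (N + 1) (by omega) (by omega) (by rwa [hm]), hm]
    have hvalid : ∀ n, Stays (κ.Rej B c) (N + 2) n x → κ.Valid B N (splice N c c' x) n :=
      fun n hn => valid_splice (hx n) hc hmv hC hC' hsig (by simp [hO])
        fun _ j h1 h2 => hn j h1 h2
    have hrejmove : ∀ n, N + 2 ≤ n → n % 2 = 1 → Stays (κ.Rej B c) (N + 2) n x →
        x n = s (res (splice N c c' x) n) ∧ x n :: res x n ∈ κ.Rej B c := by
      intro n hn hp hst
      have hm : κ.move₁ B N s x n = s (res (splice N c c' x) n) := by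
        rw [move₁, ← hQ]
        dsimp only
        rw [if_neg (hits_empty fun j h1 _ => hit j h1), if_pos (show Stays (Safe 0 T Q) (N + 1) _ x from fun j h1 _ => hsafe j h1),
          if_neg (by omega), ← hcdef, ← hc']
      have h2 := (legal_proj hs (hvalid n hst) hp).cons_rej hn (by simp [hO])
      rw [proj_splice hc hmv, splice_self] at h2
      have h3 := hmove n (by omega) hp (by rw [hm]; exact sig_subset _ (rej_subset _ h2))
      rw [h3, hm]
      exact ⟨rfl, h2⟩
    have hall : ∀ n, Stays (κ.Rej B c) (N + 2) n x := by
      intro n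
      induction n with
      | zero => exact fun j h1 h2 => by omega
      | succ n ih =>
        intro j h1 h2
        rcases eq_or_ne j (n + 1) with rfl | hne
        · rcases eq_or_lt_of_le (show N + 1 ≤ n by omega) with rfl | hn2
          · rw [PiNat.res_succ, ← hmv]
            exact h6
          · by_cases hp : n % 2 = 1
            · exact (hrejmove n hn2 hp ih).2
            · refine (isSafe_safe 1 (κ.Sig c) B).opp _ (ih n hn2 le_rfl)
                (by rwa [PiNat.res_length]) _ ?_
              rw [hSig]
              exact hsafe (n + 1) (by omega)
        · exact ih j h1 (by omega)
    refine ⟨c, c', hc, hmv, fun n => res_mem_tree.2 (hvalid n (hall n)), fun n hp => ?_⟩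
    rcases lt_or_ge n N with hn | hn
    · rw [splice_lt hn, splice_res_of_le hn.le, hf n hp, str_of_lt (by rw [PiNat.res_length]; omega)]
    rcases eq_or_lt_of_le (show N + 1 ≤ n by omega) with rfl | hn2
    · rw [splice_succ, splice_res_succ, hc']
    · rw [splice_ge hn2]
      exact (hrejmove n hn2 hp (hall n)).1

theorem cover_tree (hT : IsGameTree T) (hN : N % 2 = 0) :
    Cover N (κ.tree B N) T (κ.projPos N) (κ.str B N) where
  len h := by rw [projPos, PiNat.res_length]
  tail a h := by
    refine ⟨κ.proj N (seq (a :: h)) h.length, ?_⟩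
    rw [projPos, List.length_cons, PiNat.res_succ, projPos]
    congr 1
    exact res_congr fun m hm => proj_congr (by rw [seq, if_neg hm.ne])
  maps h hh := Valid.mem hh
  legal p hp s hs h hh hl := by
    rw [str]
    split_ifs with h1 h2
    · have hle : h.length ≤ N := by omega
      have hmem : ∀ g : List U, g.length ≤ N → (g ∈ κ.tree B N ↔ g ∈ T) := fun g hg => by
        rw [← res_seq g, res_mem_tree, valid_of_le hg]
      have hlt : h.length < N := by
        interval_cases p <;> omega
      exact (hmem (s h :: h) (by simpa using hlt)).1 (hs h ((hmem h hle).2 hh) hl)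
    · exact legalize_mem hT _ hh
    · exact legalize_mem hT _ hh
  loc p hp n s s' hs h hh := str_loc hp hs h hh
  lift p hp s hs x hx hf := by
    have key : ∀ c c', κ.mv c = x N → κ.mv c' = x (N + 1) → ∀ n,
        κ.projPos N (res (splice N c c' x) n) = res x n := fun c c' hc hc' n => by
      rw [projPos_res, proj_splice hc hc']
    interval_cases p
    · obtain ⟨c, c', hc, hc', h1, h2⟩ := lift_zero hN hs hx hf
      exact ⟨_, h1, h2, key c c' hc hc'⟩
    · obtain ⟨c, c', hc, hc', h1, h2⟩ := lift_one hN hs hx hf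
      exact ⟨_, h1, h2, key c c' hc hc'⟩
  mem h hh := by rw [← res_seq h, res_mem_tree, valid_of_le hh]
  pos h hh := by
    conv_rhs => rw [← res_seq h]
    exact res_congr fun m hm => proj_of_lt (by omega)
  str p hp s h hh := str_of_lt (by omega)

theorem decided_tree (hT : IsGameTree T) (hB : UpClosed T B) :
    Decided (κ.tree B N) {x | ∃ n, κ.projPos N (res x n) ∈ B} := by
  have key : ∀ x ∈ plays (κ.tree B N),
      (∃ n, κ.projPos N (res x n) ∈ B) ↔ κ.O (x (N + 1)) ≠ none := by
    intro x hx
    have hv := fun n => res_mem_tree.1 (hx n)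
    constructor
    · rintro ⟨n, hn⟩ hO
      rw [projPos_res] at hn
      have h1 := (hv (N + 2 + n)).rej (by omega) hO (N + 2 + n) (by omega) le_rfl
      exact (isSafe_safe _ _ _).avoid _ h1 (mem_up hT hB (by omega) hn (hv _).mem)
    · intro hO
      obtain ⟨u, hu⟩ := Option.ne_none_iff_exists'.1 hO
      obtain ⟨h1, -, -, h4⟩ := (hv (N + 2 + u.length)).acc (by omega) u hu
      refine ⟨u.length, ?_⟩
      rw [projPos_res, res_congr (y := seq u) fun m hm => h4 m (by omega) hm, res_seq]
      exact h1
  intro x hx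
  refine ⟨N + 2, fun y hy hxy => ?_⟩
  have hxy' : y (N + 1) = x (N + 1) := PiNat.res_eq_res.1 hxy (by omega)
  exact (key y hy).trans (by rw [hxy']; exact (key x hx).symm)

end Coding

end BorelGame

namespace BorelGame

variable {U : Type 1}

lemma mem_res {x : ℕ → U} {n : ℕ} {a : U} (h : a ∈ res x n) : ∃ m < n, a = x m := by
  induction n with
  | zero => simp at h
  | succ n ih =>
    rw [PiNat.res_succ, List.mem_cons] at h
    rcases h with h | h
    · exact ⟨n, n.lt_succ_self, h⟩
    · obtain ⟨m, hm, he⟩ := ih h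
      exact ⟨m, hm.trans n.lt_succ_self, he⟩

lemma small_lists (A : Set U) [Small.{0} A] : Small.{0} {h : List U | ∀ a ∈ h, a ∈ A} := by
  refine small_subset (s := Set.range fun l : List (Shrink.{0} A) =>
    l.map fun a => ((equivShrink A).symm a : U)) fun h hh => ?_
  refine ⟨h.pmap (fun a ha => equivShrink A ⟨a, ha⟩) hh, ?_⟩
  simp [List.map_pmap]

variable [Inhabited U]

lemma exists_coding (hU : ∀ α : Type, ∃ f : α → U, Function.Injective f) (T : Set (List U))
    [Small.{0} T] : ∃ κ : Coding T, Small.{0} κ.C := by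
  classical
  let S := Shrink.{0} T
  let r : S → List U := fun s => ((equivShrink T).symm s : List U)
  have hr : ∀ h ∈ T, ∃ s, r s = h := fun h hh => ⟨equivShrink T ⟨h, hh⟩, by simp [r]⟩
  obtain ⟨f, hf⟩ := hU (S × Set S × Option S)
  let g : U → Option (S × Set S × Option S) := Function.partialInv f
  have hg : ∀ e, g (f e) = some e := Function.partialInv_left hf
  let mv : U → U := fun c => ((g c).map fun e => (r e.1).headI).getD default
  let W : U → Set (List U) := fun c => ((g c).map fun e => r '' e.2.1).getD ∅
  let O : U → Option (List U) := fun c => (g c).bind fun e => e.2.2.map r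
  let P : U → Set (List U) → Option (List U) → U → Prop := fun a W' o c =>
    c ∈ Set.range f ∧ mv c = a ∧ W c = W' ∧ O c = o
  refine ⟨⟨Set.range f, mv, W, O, fun a W' o => Classical.epsilon (P a W' o), ?_⟩, ?_⟩
  · intro a h W' o ha hW ho
    refine Classical.epsilon_spec (p := P a W' o) ?_
    obtain ⟨s, hs⟩ := hr _ ha
    obtain ⟨o', ho'⟩ : ∃ o' : Option S, o'.map r = o := by
      cases o with
      | none => exact ⟨none, rfl⟩
      | some u =>
        obtain ⟨t, ht⟩ := hr u (ho u rfl)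
        exact ⟨some t, by simp [ht]⟩
    refine ⟨f (s, r ⁻¹' W', o'), ⟨_, rfl⟩, ?_, ?_, ?_⟩
    · simp [mv, hg, hs]
    · simp only [W, hg, Option.map_some, Option.getD_some]
      rw [Set.image_preimage_eq_iff]
      exact fun u hu => hr u (hW hu)
    · simp [O, hg, ho']
  · exact small_range f

lemma Coding.small_tree {T : Set (List U)} (hT : IsGameTree T) [Small.{0} T] (κ : Coding T)
    [Small.{0} κ.C] (B : Set (List U)) (N : ℕ) : Small.{0} (κ.tree B N) := by
  have h1 : Small.{0} (List.headI '' T) := inferInstance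
  have := small_lists (List.headI '' T ∪ κ.C)
  refine small_subset (s := {h : List U | ∀ a ∈ h, a ∈ List.headI '' T ∪ κ.C}) fun h hh a ha => ?_
  obtain ⟨m, hm, rfl⟩ := mem_res ((res_seq h).symm ▸ ha)
  have hv : κ.Valid B N (seq h) h.length := hh
  by_cases h2 : m = N
  · subst h2
    exact Or.inr (hv.code hm)
  by_cases h3 : m = N + 1
  · subst h3
    exact Or.inr (hv.code' hm)
  refine Or.inl ⟨_, mem_of_le hT (Nat.succ_le_of_lt hm) hv.mem, ?_⟩
  rw [PiNat.res_succ, List.headI, proj, if_neg (by tauto)]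

/-! ### Unraveling Borel sets -/

lemma lim_id (x : ℕ → U) : lim id x = x := by
  funext n
  rw [lim, id, PiNat.res_succ, List.headI]

lemma decided_comap {T' T : Set (List U)} {π : List U → List U}
    (len : ∀ h, (π h).length = h.length) (tail : ∀ a h, ∃ b, π (a :: h) = b :: π h)
    (maps : ∀ h ∈ T', π h ∈ T) {D : Set (ℕ → U)} (hD : Decided T D) :
    Decided T' {x | lim π x ∈ D} := by
  have hmem : ∀ x ∈ plays T', lim π x ∈ plays T := fun x hx n => by
    rw [res_lim len tail]
    exact maps _ (hx n)
  intro x hx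
  obtain ⟨n, hn⟩ := hD _ (hmem x hx)
  refine ⟨n, fun y hy hxy => hn _ (hmem y hy) ?_⟩
  rw [res_lim len tail, res_lim len tail, hxy]

/-- The map `f` is continuous on the plays of `T`. -/
def Cont (T : Set (List U)) (f : (ℕ → U) → ℕ → ℕ) : Prop :=
  ∀ i, ∀ x ∈ plays T, ∃ n, ∀ y ∈ plays T, res y n = res x n → f y i = f x i

/-- All continuous preimages of `X` become clopen in suitable coverings. -/
def Unravels (U : Type 1) [Inhabited U] (X : Set (ℕ → ℕ)) : Prop :=
  ∀ (T : Set (List U)) (f : (ℕ → U) → ℕ → ℕ), IsGameTree T → Small.{0} T → Cont T f → ∀ k,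
    ∃ T' π φ, IsGameTree T' ∧ Small.{0} T' ∧ Cover k T' T π φ ∧ Decided T' {x | f (lim π x) ∈ X}

lemma Cover.cont {k : ℕ} {T' T : Set (List U)} {π : List U → List U}
    {φ : ℕ → (List U → U) → List U → U} (h : Cover k T' T π φ) {f : (ℕ → U) → ℕ → ℕ}
    (hf : Cont T f) : Cont T' fun x => f (lim π x) := fun i x hx => by
  obtain ⟨n, hn⟩ := hf i _ (h.lim_mem hx)
  refine ⟨n, fun y hy hxy => hn _ (h.lim_mem hy) ?_⟩
  rw [h.res_lim, h.res_lim, hxy]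

lemma unravels_eval (i : ℕ) (S : Set ℕ) : Unravels U {z | z i ∈ S} := by
  intro T f hT hs hf k
  refine ⟨T, id, fun _ => id, hT, hs, Cover.id k T, fun x hx => ?_⟩
  obtain ⟨n, hn⟩ := hf i x hx
  refine ⟨n, fun y hy hxy => ?_⟩
  simp only [lim_id, Set.mem_ofPred_eq]
  rw [hn y hy hxy]

lemma Unravels.compl {X : Set (ℕ → ℕ)} (hX : Unravels U X) : Unravels U Xᶜ := by
  intro T f hT hs hf k
  obtain ⟨T', π, φ, hT', hs', hc, hd⟩ := hX T f hT hs hf k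
  refine ⟨T', π, φ, hT', hs', hc, fun x hx => ?_⟩
  obtain ⟨n, hn⟩ := hd x hx
  exact ⟨n, fun y hy hxy => not_congr (hn y hy hxy)⟩

/-- Open sets can be unraveled. -/
lemma exists_cover_of_open (hU : ∀ α : Type, ∃ f : α → U, Function.Injective f)
    {T : Set (List U)} (hT : IsGameTree T) [Small.{0} T] {O : Set (ℕ → U)}
    (hO : ∀ x ∈ plays T, x ∈ O → ∃ n, ∀ y ∈ plays T, res y n = res x n → y ∈ O) (k : ℕ) :
    ∃ T' π φ, IsGameTree T' ∧ Small.{0} T' ∧ Cover k T' T π φ ∧ Decided T' {x | lim π x ∈ O} := by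
  obtain ⟨κ, hκ⟩ := exists_coding hU T
  let B : Set (List U) := {h | ∀ y ∈ plays T, res y h.length = h → y ∈ O}
  have hB : UpClosed T B := fun a h _ hh y hy he => hh y hy (by
    rw [List.length_cons, PiNat.res_succ] at he
    exact (List.cons.inj he).2)
  have hN : 2 * k % 2 = 0 := by omega
  have hc := Coding.cover_tree (κ := κ) (B := B) hT hN
  refine ⟨κ.tree B (2 * k), _, _, Coding.isGameTree_tree hT hN, Coding.small_tree hT κ B _,
    hc.mono (by omega), fun x hx => ?_⟩
  have key : ∀ y ∈ plays (κ.tree B (2 * k)),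
      lim (κ.projPos (2 * k)) y ∈ O ↔ ∃ n, κ.projPos (2 * k) (res y n) ∈ B := by
    intro y hy
    constructor
    · intro h
      obtain ⟨n, hn⟩ := hO _ (hc.lim_mem hy) h
      refine ⟨n, fun z hz he => hn z hz ?_⟩
      rwa [hc.len, PiNat.res_length, ← hc.res_lim] at he
    · rintro ⟨n, hn⟩
      exact hn _ (hc.lim_mem hy) (by rw [hc.res_lim, hc.len, PiNat.res_length])
  obtain ⟨n, hn⟩ := Coding.decided_tree (κ := κ) (N := 2 * k) hT hB x hx
  exact ⟨n, fun y hy hxy => (key y hy).trans ((hn y hy hxy).trans (key x hx).symm)⟩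

lemma Unravels.iUnion (hU : ∀ α : Type, ∃ f : α → U, Function.Injective f)
    {X : ℕ → Set (ℕ → ℕ)} (hX : ∀ i, Unravels U (X i)) : Unravels U (⋃ i, X i) := by
  intro T₀ f₀ hT₀ hs₀ hf₀ k
  let State := {p : Set (List U) × ((ℕ → U) → ℕ → ℕ) // IsGameTree p.1 ∧ Small.{0} p.1 ∧ Cont p.1 p.2}
  have step : ∀ (i : ℕ) (p : State), ∃ q : State, ∃ π φ, Cover (k + i) q.1.1 p.1.1 π φ ∧
      Decided q.1.1 {x | q.1.2 x ∈ X i} ∧ q.1.2 = fun x => p.1.2 (lim π x) := by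
    rintro i ⟨⟨T, f⟩, hT, hs, hf⟩
    obtain ⟨T', π, φ, hT', hs', hc, hd⟩ := hX i T f hT hs hf (k + i)
    exact ⟨⟨⟨T', fun x => f (lim π x)⟩, hT', hs', hc.cont hf⟩, π, φ, hc, hd, rfl⟩
  choose nxt π' φ' hc' hd' he' using step
  let st : ℕ → State := fun n => Nat.rec ⟨⟨T₀, f₀⟩, hT₀, hs₀, hf₀⟩ nxt n
  let T : ℕ → Set (List U) := fun i => (st i).1.1
  let f : ℕ → (ℕ → U) → ℕ → ℕ := fun i => (st i).1.2
  let π : ℕ → List U → List U := fun i => π' i (st i)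
  have hT : ∀ i, IsGameTree (T i) := fun i => (st i).2.1
  have hs : ∀ i, Small.{0} (T i) := fun i => (st i).2.2.1
  have hc : ∀ i, Cover (k + i) (T (i + 1)) (T i) (π i) (φ' i (st i)) := fun i => hc' i (st i)
  have hd : ∀ i, Decided (T (i + 1)) {x | f (i + 1) x ∈ X i} := fun i => hd' i (st i)
  have he : ∀ i x, f (i + 1) x = f i (lim (π i) x) := fun i x => congrFun (he' i (st i)) x
  have hlim : ∀ i x, f i (lim (limPos π i) x) = f 0 (lim (limPos π 0) x) := by
    intro i x
    induction i with
    | zero => rfl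
    | succ i ih =>
      rw [he, ← ih, limPos_succ hc i, lim_comp (hc i).len (hc i).tail
        (limPos_length hc (i + 1)) (limPos_cons hc (i + 1))]
  have hcl := limit_cover hc hT
  have hTl := isGameTree_limTree hc hT
  have hsl : Small.{0} (limTree T) :=
    small_subset (s := ⋃ i, T i) fun h hh => Set.mem_iUnion.2 ⟨h.length, hh⟩
  have hdl : ∀ i, Decided (limTree T) {x | f 0 (lim (limPos π 0) x) ∈ X i} := by
    intro i
    have := decided_comap (limPos_length hc (i + 1)) (limPos_cons hc (i + 1))
      (fun h hh => limPos_mem hc (i + 1) hh) (hd i)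
    simpa only [Set.mem_ofPred_eq, hlim] using this
  obtain ⟨T', ρ, ψ, hT', hs', hcc, hdd⟩ := exists_cover_of_open hU hTl
    (O := {x | f 0 (lim (limPos π 0) x) ∈ ⋃ i, X i}) (fun x hx hxO => by
      obtain ⟨i, hi⟩ := Set.mem_iUnion.1 hxO
      obtain ⟨n, hn⟩ := hdl i x hx
      exact ⟨n, fun y hy hxy => Set.mem_iUnion.2 ⟨i, (hn y hy hxy).2 hi⟩⟩) k
  refine ⟨T', _, _, hT', hs', hcc.comp hcl, ?_⟩
  simp only [hcc.lim_comp hcl]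
  exact hdd

lemma unravels_of_measurable (hU : ∀ α : Type, ∃ f : α → U, Function.Injective f)
    {X : Set (ℕ → ℕ)} (hX : MeasurableSet X) : Unravels U X := by
  let m : MeasurableSpace (ℕ → ℕ) :=
    { MeasurableSet' := Unravels U
      measurableSet_empty := by
        have := unravels_eval (U := U) 0 ∅
        simpa using this
      measurableSet_compl := fun _ h => h.compl
      measurableSet_iUnion := fun _ h => Unravels.iUnion hU h }
  have hle : MeasurableSpace.pi ≤ m := by
    refine iSup_le fun i => ?_
    rintro _ ⟨S, -, rfl⟩
    exact unravels_eval i S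
  exact hle X hX

/-- Borel determinacy for games with natural number moves. -/
theorem borel_determinacy {X : Set (ℕ → ℕ)} (hX : MeasurableSet X) :
    (∃ s : List ℕ → ℕ, ∀ z, Follows 0 s z → z ∈ X) ∨
      (∃ s : List ℕ → ℕ, ∀ z, Follows 1 s z → z ∉ X) := by
  let U : Type 1 := Σ α : Type, α
  have hU : ∀ α : Type, ∃ f : α → U, Function.Injective f := fun α =>
    ⟨fun a => ⟨α, a⟩, fun a b h => eq_of_heq (Sigma.mk.inj h).2⟩
  have : Inhabited U := ⟨⟨ℕ, 0⟩⟩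
  obtain ⟨ι, hι⟩ := hU ℕ
  let T : Set (List U) := {h | ∀ a ∈ h, a ∈ Set.range ι}
  have hT : IsGameTree T := ⟨by simp [T], fun a h hh b hb => hh b (List.mem_cons_of_mem _ hb),
    fun h hh => ⟨ι 0, by
      intro b hb
      rcases List.mem_cons.1 hb with rfl | hb
      · exact ⟨0, rfl⟩
      · exact hh b hb⟩⟩
  have hs : Small.{0} T := small_lists _
  let d : U → ℕ := Function.invFun ι
  have hd : ∀ a, d (ι a) = a := Function.leftInverse_invFun hι
  have hplay : ∀ z : ℕ → ℕ, (fun n => ι (z n)) ∈ plays T := fun z n a ha => by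
    obtain ⟨m, -, rfl⟩ := mem_res ha
    exact ⟨_, rfl⟩
  have hres : ∀ (z : ℕ → ℕ) n, res (fun n => ι (z n)) n = (res z n).map ι := by
    intro z n
    induction n with
    | zero => rfl
    | succ n ih => rw [PiNat.res_succ, ih, PiNat.res_succ, List.map_cons]
  obtain ⟨T', π, φ, hT', -, hc, hdec⟩ := unravels_of_measurable hU hX T (fun x n => d (x n)) hT hs
    (fun i x hx => ⟨i + 1, fun y hy hxy => by
      exact congrArg d (PiNat.res_eq_res.1 hxy i.lt_succ_self)⟩) 0
  have key : ∀ p, ∀ s : List U → U, Legal p T s → ∀ z : ℕ → ℕ,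
      Follows p (fun h => d (s (h.map ι))) z → Follows p s (fun n => ι (z n)) := by
    intro p s hs z hz n hn
    have h1 : s (res (fun n => ι (z n)) n) ∈ Set.range ι :=
      hs _ (hplay z n) (by rwa [PiNat.res_length]) _ List.mem_cons_self
    obtain ⟨a, ha⟩ := h1
    have := hz n hn
    beta_reduce at this ⊢
    rw [this, ← hres, ← ha, hd]
  rcases hc.determined (D := {x | (fun n => d (x n)) ∈ X}) (decided_determinacy hT' hdec) with
    ⟨s, hs, hw⟩ | ⟨s, hs, hw⟩
  · refine Or.inl ⟨fun h => d (s (h.map ι)), fun z hz => ?_⟩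
    have := hw _ (hplay z) (key 0 s hs z hz)
    simpa [hd] using this
  · refine Or.inr ⟨fun h => d (s (h.map ι)), fun z hz => ?_⟩
    have := hw _ (hplay z) (key 1 s hs z hz)
    simpa [hd] using this

end BorelGame

namespace TwoSubgroups

open Relation

variable {G X : Type*} [Group G] [MulAction G X] (H : Bool → Subgroup G)

/-! ### Words in two subgroups -/

/-- The product of a word, the first letter acting first. -/
def ev : List (Bool × G) → G
  | [] => 1
  | a :: l => ev l * a.2

lemma ev_append (l l' : List (Bool × G)) : ev (l ++ l') = ev l' * ev l := by
  induction l with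
  | nil => simp [ev]
  | cons a l ih => simp [ev, ih, mul_assoc]

/-- The letters of type `p` belong to `H p`. -/
def Letters (l : List (Bool × G)) : Prop := ∀ a ∈ l, a.2 ∈ H a.1

/-- The point `z` is fixed by the nontrivial product of the word `l`. -/
def Fixes (l : List (Bool × G)) (z : X) : Prop := Letters H l ∧ ev l ≠ 1 ∧ ev l • z = z

/-- One step in the graph whose vertices are the orbits of `H true` and of `H false`, and whose
edges are the points of `X`: leave an `H p`-orbit along an edge which `S` assigns to it. -/
def Step (S : Set X) (u v : Bool × X) : Prop :=
  v.1 = !u.1 ∧ ∃ h ∈ H u.1, v.2 = h • u.2 ∧ (v.2 ∈ S ↔ u.1 = true)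

/-- The points whose `H p`-orbit lies on a closed walk. -/
def Cyc (S : Set X) (p : Bool) : Set X :=
  {z | ∃ k ∈ H p, TransGen (Step H S) (p, z) (p, k • z)}

variable {H}

lemma Step.of_smul {S : Set X} {p : Bool} {z : X} {k : G} {v : Bool × X} (hk : k ∈ H p)
    (h : Step H S (p, k • z) v) : Step H S (p, z) v := by
  obtain ⟨h1, h, hh, h2, h3⟩ := h
  exact ⟨h1, h * k, mul_mem hh hk, by rw [h2, mul_smul], h3⟩

lemma Step.smul {S : Set X} {p : Bool} {z : X} {k : G} {v : Bool × X} (hk : k ∈ H p)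
    (h : Step H S (p, z) v) : Step H S (p, k • z) v :=
  Step.of_smul (inv_mem hk) (by rwa [inv_smul_smul])

lemma Cyc.smul {S : Set X} {p : Bool} {z : X} {k : G} (hk : k ∈ H p) (h : z ∈ Cyc H S p) :
    k • z ∈ Cyc H S p := by
  obtain ⟨g, hg, h⟩ := h
  refine ⟨g * k⁻¹, mul_mem hg (inv_mem hk), ?_⟩
  rw [mul_smul, inv_smul_smul]
  obtain ⟨v, h1, h2⟩ := TransGen.head'_iff.1 h
  exact TransGen.head' (h1.smul hk) h2

lemma Cyc.exists_step {S : Set X} {p : Bool} {z : X} (h : z ∈ Cyc H S p) :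
    ∃ g ∈ H p, (g • z ∈ S ↔ p = true) ∧ g • z ∈ Cyc H S (!p) := by
  obtain ⟨k, hk, h⟩ := h
  obtain ⟨⟨q, w⟩, h1, h2⟩ := TransGen.head'_iff.1 h
  have h3 := h1.smul hk
  obtain ⟨hq, g, hg, hw, hS⟩ := h1
  simp only at hq hw hS hg
  subst hq hw
  exact ⟨g, hg, hS, 1, one_mem _, by rw [one_smul]; exact TransGen.tail' h2 h3⟩

lemma transGen_of_word {S : Set X} (l : List (Bool × G)) (hl : l ≠ []) (z : X)
    (hH : Letters H l) (hc : l.IsChain fun a b => b.1 = !a.1)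
    (hS : ∀ l₁ a l₂, l = l₁ ++ a :: l₂ → (ev (l₁ ++ [a]) • z ∈ S ↔ a.1 = true)) :
    TransGen (Step H S) ((l.head hl).1, z) (!(l.getLast hl).1, ev l • z) := by
  induction l generalizing z with
  | nil => exact absurd rfl hl
  | cons a l ih =>
    have h1 : Step H S (a.1, z) (!a.1, a.2 • z) :=
      ⟨rfl, a.2, hH a List.mem_cons_self, rfl, by simpa [ev] using hS [] a l rfl⟩
    rcases l with _ | ⟨b, l⟩
    · simpa [ev] using TransGen.single h1
    · have h2 := ih (by simp) (a.2 • z) (fun c hc => hH c (List.mem_cons_of_mem _ hc)) hc.tail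
        (fun l₁ c l₂ he => by
          have := hS (a :: l₁) c l₂ (by rw [he, List.cons_append])
          rwa [List.cons_append, ev, mul_smul] at this)
      have hb : b.1 = !a.1 := by simpa using (List.isChain_cons_cons.1 hc).1
      refine TransGen.head h1 ?_
      rw [List.head_cons, hb, ← mul_smul] at h2
      simpa [ev, List.getLast_cons] using h2

section Minimal

variable {y : X} {l : List (Bool × G)}

/-- In the orbit of `y` no point is fixed by the product of a shorter word. -/
def Minimal (H : Bool → Subgroup G) (y : X) (l : List (Bool × G)) : Prop :=
  ∀ (l' : List (Bool × G)) (g : G), Fixes H l' (g • y) → l.length ≤ l'.length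

lemma Minimal.isChain (hm : Minimal H y l) {g : G} (hf : Fixes H l (g • y)) :
    l.IsChain fun a b => b.1 = !a.1 := by
  rw [List.isChain_iff_forall_rel_of_append_cons_cons]
  rintro a b l₁ l₂ rfl
  by_contra hab
  have hab : b.1 = a.1 := by
    revert hab
    cases a.1 <;> cases b.1 <;> simp
  have hlen := hm (l₁ ++ (a.1, b.2 * a.2) :: l₂) g ⟨fun c hc => ?_, ?_, ?_⟩
  · simp at hlen
  · rcases List.mem_append.1 hc with hc | hc
    · exact hf.1 c (by simp [hc])
    · rcases List.mem_cons.1 hc with rfl | hc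
      · exact mul_mem (hab ▸ hf.1 b (by simp)) (hf.1 a (by simp))
      · exact hf.1 c (by simp [hc])
  · simpa [ev_append, ev, mul_assoc] using hf.2.1
  · simpa [ev_append, ev, mul_assoc] using hf.2.2

lemma Minimal.head_getLast (hm : Minimal H y l) {g : G} (hf : Fixes H l (g • y))
    (hfree : ∀ p, ∀ h ∈ H p, ∀ g : G, h • g • y = g • y → h = 1) (hl : l ≠ []) :
    (l.head hl).1 = !(l.getLast hl).1 := by
  rcases l with _ | ⟨a, l⟩
  · exact absurd rfl hl
  have hf' : Fixes H (l ++ [a]) ((a.2 * g) • y) := by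
    obtain ⟨h1, h2, h3⟩ := hf
    refine ⟨fun c hc => h1 c (by simpa [or_comm] using hc), fun he => h2 ?_, ?_⟩
    · simp only [ev_append, ev, one_mul] at he ⊢
      rw [mul_eq_one_iff_eq_inv] at he ⊢
      rw [he, inv_inv]
    · rw [ev, mul_smul] at h3
      rw [ev_append, mul_smul, mul_smul, h3]
      simp [ev]
  have hm' : Minimal H y (l ++ [a]) := fun l' g' h => by simpa using hm l' g' h
  have hc := hm'.isChain hf'
  rcases List.eq_nil_or_concat l with rfl | ⟨l, b, rfl⟩
  · have h1 := hfree a.1 a.2 (hf.1 a (by simp)) g (by simpa [ev] using hf.2.2)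
    exact absurd (by simp [ev, h1]) hf.2.1
  · rw [List.isChain_iff_forall_rel_of_append_cons_cons] at hc
    have := hc (a := b) (b := a) (l₁ := l) (l₂ := []) (by simp)
    simpa using this

lemma Minimal.ne (hm : Minimal H y l) {g : G} (hf : Fixes H l (g • y))
    {u v w : List (Bool × G)} (he : l = u ++ (v ++ w)) (hu : u ≠ []) (hv : v ≠ []) :
    ev u • g • y ≠ ev (u ++ v) • g • y := by
  intro h
  subst he
  have hul := List.length_pos_of_ne_nil hu
  have hvl := List.length_pos_of_ne_nil hv
  rw [ev_append, mul_smul] at h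
  have hv1 : ev v = 1 := by
    by_contra hv1
    have := hm v (ev u * g) ⟨fun c hc => hf.1 c (by simp [hc]), hv1, by rw [mul_smul, ← h]⟩
    simp only [List.length_append] at this
    omega
  have h1 : ev (u ++ (v ++ w)) = ev (u ++ w) := by simp [ev_append, hv1]
  have := hm (u ++ w) g ⟨fun c hc => hf.1 c ?_, h1 ▸ hf.2.1, h1 ▸ hf.2.2⟩
  · simp only [List.length_append] at this
    omega
  · rcases List.mem_append.1 hc with hc | hc <;> simp [hc]

lemma Minimal.eq_of_eq (hm : Minimal H y l) {g : G} (hf : Fixes H l (g • y))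
    {l₁ l₂ l₁' l₂' : List (Bool × G)} {a a' : Bool × G} (he : l = l₁ ++ a :: l₂)
    (he' : l = l₁' ++ a' :: l₂')
    (h : ev (l₁ ++ [a]) • g • y = ev (l₁' ++ [a']) • g • y) : a = a' := by
  have key : ∀ {l₁ l₂ l₁' l₂' e : List (Bool × G)} {a a' : Bool × G}, l = l₁ ++ a :: l₂ →
      ev (l₁ ++ [a]) • g • y = ev (l₁' ++ [a']) • g • y →
      l₁' = l₁ ++ e → a :: l₂ = e ++ a' :: l₂' → a = a' := by
    intro l₁ l₂ l₁' l₂' e a a' he h h1 h2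
    rcases e with _ | ⟨b, e⟩
    · exact (List.cons.inj h2).1
    · obtain ⟨rfl, h3⟩ := List.cons.inj h2
      refine absurd ?_ (hm.ne hf (u := l₁ ++ [a]) (v := e ++ [a']) (w := l₂') ?_ (by simp)
        (by simp))
      · rw [h, h1]
        simp
      · rw [he, h3]
        simp
  rcases List.append_eq_append_iff.1 (he.symm.trans he') with ⟨e, h1, h2⟩ | ⟨e, h1, h2⟩
  · exact key he h h1 h2
  · exact (key he' h.symm h1 h2).symm

end Minimal

/-- An orbit which is not free, but on which both subgroups act freely, has a vertex lying on a
closed walk, for one of the given assignments. -/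
lemma exists_cyc {S : ℕ → Set X}
    (hS : ∀ Q Q' : Set X, Q.Finite → ∃ j, ∀ z ∈ Q, (z ∈ S j ↔ z ∈ Q')) {y : X}
    (hfree : ∀ p, ∀ h ∈ H p, ∀ g : G, h • g • y = g • y → h = 1)
    (hfix : ∃ (l : List (Bool × G)) (g : G), Fixes H l (g • y)) :
    ∃ j p, ∃ g : G, g • y ∈ Cyc H (S j) p := by
  classical
  have hex : ∃ n, ∃ (l : List (Bool × G)) (g : G), Fixes H l (g • y) ∧ l.length = n := by
    obtain ⟨l, g, h⟩ := hfix
    exact ⟨_, l, g, h, rfl⟩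
  obtain ⟨l, g, hf, hlen⟩ := Nat.find_spec hex
  have hm : Minimal H y l := fun l' g' h => hlen ▸ Nat.find_min' hex ⟨l', g', h, rfl⟩
  have hl : l ≠ [] := by
    rintro rfl
    exact hf.2.1 rfl
  obtain ⟨j, hj⟩ := hS
    {w | ∃ l₁ a l₂, l = l₁ ++ a :: l₂ ∧ w = ev (l₁ ++ [a]) • g • y}
    {w | ∃ l₁ a l₂, l = l₁ ++ a :: l₂ ∧ w = ev (l₁ ++ [a]) • g • y ∧ a.1 = true} (by
      refine ((Finset.range (l.length + 1)).finite_toSet.image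
        fun i => ev (l.take i) • g • y).subset ?_
      rintro _ ⟨l₁, a, l₂, he, rfl⟩
      refine ⟨l₁.length + 1, ?_, ?_⟩
      · simp [he]
      · simp [he, List.take_append, List.take_of_length_le])
  refine ⟨j, (l.head hl).1, g, 1, one_mem _, ?_⟩
  have := transGen_of_word (S := S j) l hl (g • y) hf.1 (hm.isChain hf) fun l₁ a l₂ he => by
    refine (hj _ ⟨l₁, a, l₂, he, rfl⟩).trans ⟨?_, fun ha => ⟨l₁, a, l₂, he, rfl, ha⟩⟩
    rintro ⟨l₁', a', l₂', he', h, ha⟩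
    rw [hm.eq_of_eq hf he he' h, ha]
  rw [← hm.head_getLast hf hfree hl, hf.2.2] at this
  rwa [one_smul]

/-! ### Measurability -/

section Measurable

variable [Countable G] [MeasurableSpace X]

/-- A relation all whose pieces given by group elements are measurable. -/
structure Nice (R : Bool × X → Bool × X → Prop) : Prop where
  orbit : ∀ u v, R u v → ∃ g : G, v.2 = g • u.2
  meas : ∀ p q (g : G), MeasurableSet {z : X | R (p, z) (q, g • z)}

lemma Nice.comp (hG : ∀ g : G, Measurable fun z : X => g • z) {R R' : Bool × X → Bool × X → Prop}
    (h : Nice (G := G) R) (h' : Nice (G := G) R') : Nice (G := G) (Relation.Comp R R') where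
  orbit := by
    rintro u w ⟨v, h1, h2⟩
    obtain ⟨g, hg⟩ := h.orbit u v h1
    obtain ⟨g', hg'⟩ := h'.orbit v w h2
    exact ⟨g' * g, by rw [hg', hg, mul_smul]⟩
  meas p q g := by
    have : {z : X | Relation.Comp R R' (p, z) (q, g • z)} = ⋃ (r : Bool) (k : G),
        {z | R (p, z) (r, k • z)} ∩
          (fun z => k • z) ⁻¹' {z | R' (r, z) (q, (g * k⁻¹) • z)} := by
      ext z
      simp only [Set.mem_iUnion, Set.mem_inter_iff, Set.mem_preimage, Set.mem_ofPred_eq,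
        smul_smul, inv_mul_cancel_right]
      constructor
      · rintro ⟨⟨r, w⟩, h1, h2⟩
        obtain ⟨k, rfl⟩ := h.orbit _ _ h1
        exact ⟨r, k, h1, h2⟩
      · rintro ⟨r, k, h1, h2⟩
        exact ⟨_, h1, h2⟩
    rw [this]
    exact MeasurableSet.iUnion fun r => MeasurableSet.iUnion fun k =>
      (h.meas _ _ _).inter (hG k (h'.meas _ _ _))

lemma Nice.transGen (hG : ∀ g : G, Measurable fun z : X => g • z)
    {R : Bool × X → Bool × X → Prop} (h : Nice (G := G) R) : Nice (G := G) (TransGen R) := by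
  let Rn : ℕ → Bool × X → Bool × X → Prop := fun n => Nat.rec R (fun _ S => Relation.Comp S R) n
  have hn : ∀ n, Nice (G := G) (Rn n) := by
    intro n
    induction n with
    | zero => exact h
    | succ n ih => exact ih.comp hG h
  have key : ∀ u v, TransGen R u v ↔ ∃ n, Rn n u v := by
    intro u v
    constructor
    · intro huv
      induction huv with
      | single h => exact ⟨0, h⟩
      | tail _ h ih =>
        obtain ⟨n, hn⟩ := ih
        exact ⟨n + 1, _, hn, h⟩
    · rintro ⟨n, hn⟩
      induction n generalizing v with
      | zero => exact TransGen.single hn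
      | succ n ih =>
        obtain ⟨w, h1, h2⟩ := hn
        exact (ih w h1).tail h2
  refine ⟨fun u v huv => ?_, fun p q g => ?_⟩
  · obtain ⟨n, h'⟩ := (key u v).1 huv
    exact (hn n).orbit u v h'
  · simp only [key]
    rw [Set.ofPred_exists]
    exact MeasurableSet.iUnion fun n => (hn n).meas p q g

variable (hG : ∀ g : G, Measurable fun z : X => g • z)
  (hfix : ∀ g : G, MeasurableSet {z : X | g • z = z})

include hG hfix

lemma nice_step {S : Set X} (hS : MeasurableSet S) : Nice (G := G) (Step H S) := by
  refine ⟨fun u v => ?_, fun p q g => ?_⟩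
  · rintro ⟨-, h, -, h2, -⟩
    exact ⟨h, h2⟩
  · have : {z : X | Step H S (p, z) (q, g • z)} = {z | q = !p} ∩ ⋃ (h ∈ H p),
        ({z | (h⁻¹ * g) • z = z} ∩ (fun z => g • z) ⁻¹' {w | w ∈ S ↔ p = true}) := by
      ext z
      simp only [Step, Set.mem_ofPred_eq, Set.mem_inter_iff, Set.mem_iUnion, Set.mem_preimage,
        mul_smul, inv_smul_eq_iff, exists_prop]
    rw [this]
    refine (MeasurableSet.const _).inter (MeasurableSet.biUnion (Set.to_countable _) fun h _ =>
      (hfix _).inter (hG g ?_))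
    exact hS.iff (MeasurableSet.const _)

lemma measurableSet_cyc {S : Set X} (hS : MeasurableSet S) (p : Bool) :
    MeasurableSet (Cyc H S p) := by
  have : Cyc H S p = ⋃ k ∈ H p, {z | TransGen (Step H S) (p, z) (p, k • z)} := by
    ext z
    simp [Cyc]
  rw [this]
  exact MeasurableSet.biUnion (Set.to_countable _) fun k _ =>
    ((nice_step hG hfix hS).transGen hG).meas p p k

end Measurable

variable (H)

/-- The points whose `H p`-orbit has distance at most `n` from the set `D`. -/
def Level (D : Bool → Set X) : ℕ → Bool → Set X
  | 0, p => D p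
  | n + 1, p => {z | ∃ h ∈ H p, h • z ∈ Level D n (!p)}

/-- The points whose `H p`-orbit is not free. -/
def Bad (p : Bool) : Set X := {z | ∃ h ∈ H p, h ≠ 1 ∧ h • z = z}

variable {H}

lemma Bad.smul {p : Bool} {z : X} {k : G} (hk : k ∈ H p) (hz : z ∈ Bad H p) :
    k • z ∈ Bad H p := by
  obtain ⟨h, hh, h1, h2⟩ := hz
  refine ⟨k * h * k⁻¹, mul_mem (mul_mem hk hh) (inv_mem hk), fun he => h1 ?_, ?_⟩
  · rwa [mul_inv_eq_one, mul_eq_left] at he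
  · rw [smul_smul, inv_mul_cancel_right, mul_smul, h2]

lemma Level.smul {D : Bool → Set X} (hD : ∀ p, ∀ k ∈ H p, ∀ z ∈ D p, k • z ∈ D p) {n : ℕ}
    {p : Bool} {z : X} {k : G} (hk : k ∈ H p) (hz : z ∈ Level H D n p) :
    k • z ∈ Level H D n p := by
  cases n with
  | zero => exact hD p k hk z hz
  | succ n =>
    obtain ⟨h, hh, h1⟩ := hz
    exact ⟨h * k⁻¹, mul_mem hh (inv_mem hk), by rwa [smul_smul, inv_mul_cancel_right]⟩

lemma Level.smul_iff {D : Bool → Set X} (hD : ∀ p, ∀ k ∈ H p, ∀ z ∈ D p, k • z ∈ D p) {n : ℕ}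
    {p : Bool} {z : X} {k : G} (hk : k ∈ H p) : k • z ∈ Level H D n p ↔ z ∈ Level H D n p :=
  ⟨fun h => by simpa using Level.smul hD (inv_mem hk) h, Level.smul hD hk⟩

lemma exists_level {D : Bool → Set X} (hD : ∀ p, ∀ k ∈ H p, ∀ z ∈ D p, k • z ∈ D p)
    (l : List (Bool × G)) (hl : Letters H l) {y : X} {p : Bool} (hy : ev l • y ∈ D p) (q : Bool) :
    ∃ n, y ∈ Level H D n q := by
  have aux : ∀ {n : ℕ} {z : X} {p q : Bool}, z ∈ Level H D n p → ∃ n, z ∈ Level H D n q := by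
    intro n z p q hz
    by_cases hpq : p = q
    · exact ⟨n, hpq ▸ hz⟩
    · refine ⟨n + 1, 1, one_mem _, ?_⟩
      rw [one_smul]
      rwa [show (!q) = p by revert hpq; cases p <;> cases q <;> simp]
  induction l generalizing y q with
  | nil =>
    exact aux (n := 0) (p := p) (by simpa [ev, Level] using hy)
  | cons a l ih =>
    rw [ev, mul_smul] at hy
    obtain ⟨n, hn⟩ := ih (fun b hb => hl b (List.mem_cons_of_mem _ hb)) hy a.1
    exact aux ((Level.smul_iff hD (hl a List.mem_cons_self)).1 hn)

variable [Countable G] [MeasurableSpace X]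

lemma measurableSet_level (hG : ∀ g : G, Measurable fun z : X => g • z) {D : Bool → Set X}
    (hD : ∀ p, MeasurableSet (D p)) (n : ℕ) (p : Bool) : MeasurableSet (Level H D n p) := by
  induction n generalizing p with
  | zero => exact hD p
  | succ n ih =>
    have : Level H D (n + 1) p = ⋃ h ∈ H p, (fun z => h • z) ⁻¹' Level H D n (!p) := by
      ext z
      simp [Level]
    rw [this]
    exact MeasurableSet.biUnion (Set.to_countable _) fun h _ => hG h (ih _)

/-- Choose, in each orbit which meets one of the sets `C j p`, the least such `j`. -/
lemma exists_uniform (hG : ∀ g : G, Measurable fun z : X => g • z) {S : ℕ → Set X}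
    (hS : ∀ j, MeasurableSet (S j)) {C : ℕ → Bool → Set X}
    (hC : ∀ j p, MeasurableSet (C j p)) : ∃ (S' : Set X) (C' : Bool → Set X),
      MeasurableSet S' ∧ (∀ p, MeasurableSet (C' p)) ∧
      ∀ y : X, ((∃ j p, ∃ g : G, g • y ∈ C j p) ∨ ∀ (g : G) p, g • y ∉ C' p) ∧
        ((∃ j p, ∃ g : G, g • y ∈ C j p) → (∃ p, ∃ g : G, g • y ∈ C' p) ∧
          ∃ j, ∀ g : G, (g • y ∈ S' ↔ g • y ∈ S j) ∧ ∀ p, g • y ∈ C' p ↔ g • y ∈ C j p) := by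
  let E : ℕ → Set X := fun j => ⋃ (g : G) (p : Bool), (fun z => g • z) ⁻¹' C j p
  have hE : ∀ j, MeasurableSet (E j) := fun j =>
    MeasurableSet.iUnion fun g => MeasurableSet.iUnion fun p => hG g (hC j p)
  have hmem : ∀ j y, y ∈ E j ↔ ∃ (g : G) (p : Bool), g • y ∈ C j p := fun j y => by simp [E]
  have hEs : ∀ j y, ∀ g : G, g • y ∈ E j ↔ y ∈ E j := by
    intro j y g
    rw [hmem, hmem]
    constructor
    · rintro ⟨k, p, h⟩
      exact ⟨k * g, p, by rwa [mul_smul]⟩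
    · rintro ⟨k, p, h⟩
      exact ⟨k * g⁻¹, p, by rwa [smul_smul, inv_mul_cancel_right]⟩
  let L : ℕ → Set X := fun j => E j \ ⋃ i < j, E i
  have hL : ∀ j, MeasurableSet (L j) := fun j =>
    (hE j).diff (MeasurableSet.biUnion (Set.to_countable _) fun i _ => hE i)
  have hLs : ∀ j y, ∀ g : G, g • y ∈ L j ↔ y ∈ L j := fun j y g => by
    simp only [L, Set.mem_sdiff, Set.mem_iUnion, hEs]
  have huniq : ∀ i j y, y ∈ L i → y ∈ L j → i = j := by
    intro i j y hi hj
    rcases lt_trichotomy i j with h | h | h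
    · exact absurd (Set.mem_iUnion₂.2 ⟨i, h, hi.1⟩) hj.2
    · exact h
    · exact absurd (Set.mem_iUnion₂.2 ⟨j, h, hj.1⟩) hi.2
  refine ⟨⋃ j, L j ∩ S j, fun p => ⋃ j, L j ∩ C j p,
    MeasurableSet.iUnion fun j => (hL j).inter (hS j),
    fun p => MeasurableSet.iUnion fun j => (hL j).inter (hC j p), fun y => ⟨?_, ?_⟩⟩
  · by_cases h : ∃ j p, ∃ g : G, g • y ∈ C j p
    · exact Or.inl h
    · refine Or.inr fun g p hg => ?_
      obtain ⟨j, hj⟩ := Set.mem_iUnion.1 hg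
      exact h ⟨j, p, g, hj.2⟩
  · intro h
    classical
    have h' : ∃ j, y ∈ E j := by
      obtain ⟨j, p, g, hg⟩ := h
      exact ⟨j, (hmem j y).2 ⟨g, p, hg⟩⟩
    have hj : y ∈ L (Nat.find h') := by
      refine ⟨Nat.find_spec h', fun hi => ?_⟩
      simp only [Set.mem_iUnion] at hi
      obtain ⟨i, hi, hiy⟩ := hi
      exact Nat.find_min h' hi hiy
    have key : ∀ (B : ℕ → Set X) (g : G),
        g • y ∈ ⋃ j, L j ∩ B j ↔ g • y ∈ B (Nat.find h') := by
      intro B g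
      rw [Set.mem_iUnion]
      constructor
      · rintro ⟨i, h1, h2⟩
        rw [hLs] at h1
        rwa [← huniq i _ y h1 hj]
      · exact fun hB => ⟨_, (hLs _ _ _).2 hj, hB⟩
    refine ⟨?_, _, fun g => ⟨key S g, fun p => key (fun j => C j p) g⟩⟩
    obtain ⟨g, p, hg⟩ := (hmem _ _).1 hj.1
    exact ⟨p, g, (key (fun j => C j p) g).2 hg⟩

/-- On the non-free part of an action of a group generated by two subgroups, there is a Borel
set which meets each orbit of the first subgroup, and whose complement meets each orbit of
the second one, except possibly for orbits on which that subgroup does not act freely. -/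
theorem exists_coloring (hG : ∀ g : G, Measurable fun z : X => g • z)
    (hfix : ∀ g : G, MeasurableSet {z : X | g • z = z}) {S : ℕ → Set X}
    (hSm : ∀ j, MeasurableSet (S j))
    (hS : ∀ Q Q' : Set X, Q.Finite → ∃ j, ∀ z ∈ Q, (z ∈ S j ↔ z ∈ Q'))
    (hgen : ∀ g : G, ∃ l, Letters H l ∧ ev l = g) :
    ∃ c : Set X, MeasurableSet c ∧ ∀ y : X, (∃ g : G, g ≠ 1 ∧ g • y = y) →
      ∀ p, (∀ h ∈ H p, h • y = y → h = 1) → ∃ h ∈ H p, (h • y ∈ c ↔ p = true) := by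
  obtain ⟨S', C', hS', hC', hu⟩ := exists_uniform hG hSm
    (C := fun j p => Cyc H (S j) p) fun j p => measurableSet_cyc hG hfix (hSm j) p
  have hBm : ∀ p, MeasurableSet (Bad H p : Set X) := fun p => by
    have : (Bad H p : Set X) = ⋃ h ∈ {h | h ∈ H p ∧ h ≠ 1}, {z | h • z = z} := by
      ext z
      simp [Bad, and_assoc]
    rw [this]
    exact MeasurableSet.biUnion (Set.to_countable _) fun h _ => hfix h
  let D : Bool → Set X := fun p => Bad H p ∪ C' p
  have hC's : ∀ p, ∀ k ∈ H p, ∀ z ∈ C' p, k • z ∈ C' p := by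
    intro p k hk z hz
    rcases (hu z).1 with h | h
    · obtain ⟨-, j, hj⟩ := (hu z).2 h
      rw [(hj k).2]
      refine Cyc.smul hk ?_
      have := ((hj 1).2 p).1 (by rwa [one_smul])
      rwa [one_smul] at this
    · exact absurd (by rwa [one_smul]) (h 1 p)
  have hC'step : ∀ p, ∀ z ∈ C' p, ∃ g ∈ H p, (g • z ∈ S' ↔ p = true) ∧ g • z ∈ C' (!p) := by
    intro p z hz
    rcases (hu z).1 with h | h
    · obtain ⟨-, j, hj⟩ := (hu z).2 h
      have := ((hj 1).2 p).1 (by rwa [one_smul])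
      rw [one_smul] at this
      obtain ⟨g, hg, h1, h2⟩ := Cyc.exists_step this
      exact ⟨g, hg, (hj g).1.trans h1, ((hj g).2 _).2 h2⟩
    · exact absurd (by rwa [one_smul]) (h 1 p)
  have hDs : ∀ p, ∀ k ∈ H p, ∀ z ∈ D p, k • z ∈ D p := fun p k hk z hz =>
    hz.imp (Bad.smul hk) (hC's p k hk z)
  have hLm := fun n p => measurableSet_level (H := H) hG (D := D)
    (fun p => (hBm p).union (hC' p)) n p
  let B : Set X := C' true ∩ C' false
  let N : Set X := ⋃ n, Level H D n false ∩ ⋂ m ≤ n, (Level H D m true)ᶜ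
  refine ⟨(B ∩ S') ∪ (Bᶜ ∩ N), ?_, fun y hy p hp => ?_⟩
  · have hB : MeasurableSet B := (hC' _).inter (hC' _)
    exact (hB.inter hS').union (hB.compl.inter (MeasurableSet.iUnion fun n =>
      (hLm n _).inter (MeasurableSet.biInter (Set.to_countable _) fun m _ => (hLm m _).compl)))
  -- some vertex of the orbit lies in the core
  have hcore : ∃ p, ∃ g : G, g • y ∈ D p := by
    by_cases hbad : ∃ p, ∃ g : G, g • y ∈ Bad H p
    · obtain ⟨p, g, h⟩ := hbad
      exact ⟨p, g, Or.inl h⟩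
    · push Not at hbad
      obtain ⟨g, hg, hgy⟩ := hy
      obtain ⟨l, hl, rfl⟩ := hgen g
      have h1 := exists_cyc (H := H) hS (y := y) (fun p h hh g he => by
        by_contra h1
        exact hbad p g ⟨h, hh, h1, he⟩) ⟨l, 1, hl, hg, by rwa [one_smul]⟩
      obtain ⟨⟨p, g, h⟩, -⟩ := (hu y).2 h1
      exact ⟨p, g, Or.inr h⟩
  classical
  have hlev : ∃ n, y ∈ Level H D n p := by
    obtain ⟨q, g, h⟩ := hcore
    obtain ⟨l, hl, rfl⟩ := hgen g
    exact exists_level hDs l hl h p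
  rcases hn : Nat.find hlev with _ | n
  · have h0 := Nat.find_spec hlev
    rw [hn] at h0
    rcases h0 with ⟨h, hh, h1, h2⟩ | h0
    · exact absurd (hp h hh h2) h1
    · obtain ⟨g, hg, h1, h2⟩ := hC'step p y h0
      refine ⟨g, hg, ?_⟩
      have h3 := hC's p g hg y h0
      have hB : g • y ∈ B := by
        cases p
        · exact ⟨h2, h3⟩
        · exact ⟨h3, h2⟩
      simp only [Set.mem_union, Set.mem_inter_iff, hB, Set.mem_compl_iff, not_true_eq_false,
        false_and, or_false, true_and, h1]
  · have h0 := Nat.find_spec hlev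
    rw [hn] at h0
    obtain ⟨h, hh, h1⟩ := h0
    refine ⟨h, hh, ?_⟩
    have h2 : ∀ m ≤ n, h • y ∉ Level H D m p := fun m hm => by
      rw [Level.smul_iff hDs hh]
      exact Nat.find_min hlev (by omega)
    have hB : h • y ∉ B := by
      intro hB
      refine h2 0 (Nat.zero_le _) (Or.inr ?_)
      cases p
      · exact hB.2
      · exact hB.1
    simp only [Set.mem_union, Set.mem_inter_iff, hB, Set.mem_compl_iff, not_false_eq_true,
      false_and, false_or, true_and]
    cases p
    · simp only [Bool.false_eq_true, iff_false]
      intro hN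
      obtain ⟨m, h3, h4⟩ := Set.mem_iUnion.1 hN
      simp only [Set.mem_iInter] at h4
      by_cases hmn : m ≤ n
      · exact h2 m hmn h3
      · exact h4 n (by omega) h1
    · simp only [iff_true]
      refine Set.mem_iUnion.2 ⟨n, h1, ?_⟩
      simp only [Set.mem_iInter]
      exact fun m hm => h2 m hm

end TwoSubgroups

/-! ### Reduced words in a free product -/

/-- The elements of `G` have unique reduced decompositions with respect to the homomorphisms
`ι p`. The first letter of `g` comes from the factor `typ g`, and removing it decreases `code`. -/
structure FreeDecomp {G : Type} [Group G] {K : Bool → Type} [∀ p, Group (K p)]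
    (ι : ∀ p, K p →* G) where
  /-- The factor of the first letter. -/
  typ : G → Option Bool
  /-- A numbering of the elements. -/
  code : G → ℕ
  code_injective : Function.Injective code
  typ_eq_none : ∀ g, typ g = none ↔ g = 1
  exists_eq : ∀ g p, typ g = some p → ∃ k g', k ≠ 1 ∧ g = ι p k * g' ∧ typ g' ≠ some p
  typ_mul : ∀ p k g, k ≠ 1 → typ g ≠ some p → typ (ι p k * g) = some p
  code_lt : ∀ p k g, k ≠ 1 → typ g ≠ some p → code g < code (ι p k * g)

namespace FreeDecomp

section Construction

open Monoid

variable {K : Bool → Type} [∀ p, Group (K p)] [∀ p, Countable (K p)]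

theorem nonempty_of_mulEquiv {G : Type} [Group G] (e : G ≃* CoprodI K) :
    Nonempty (FreeDecomp fun p => (e.symm : CoprodI K →* G).comp (CoprodI.of : K p →* _)) := by
  classical
  let := fun p => Encodable.ofCountable (K p)
  have hmul : ∀ p k g, k ≠ 1 → (CoprodI.Word.equiv (e g)).fstIdx ≠ some p →
      (CoprodI.Word.equiv (e (e.symm (CoprodI.of (M := K) (i := p) k) * g))).toList =
        ⟨p, k⟩ :: (CoprodI.Word.equiv (e g)).toList := by
    intro p k g hk hg
    have : CoprodI.Word.equiv (e (e.symm (CoprodI.of (M := K) (i := p) k) * g)) =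
        CoprodI.Word.cons k (CoprodI.Word.equiv (e g)) hg hk := by
      rw [← Equiv.eq_symm_apply, map_mul, MulEquiv.apply_symm_apply]
      change _ = CoprodI.Word.prod _
      rw [CoprodI.Word.prod_cons]
      congr 1
      exact (CoprodI.Word.equiv.symm_apply_apply (e g)).symm
    rw [this]
    rfl
  refine ⟨⟨fun g => (CoprodI.Word.equiv (e g)).fstIdx,
    fun g => Encodable.encode (CoprodI.Word.equiv (e g)).toList, fun g g' h => ?_, fun g => ?_,
    fun g p h => ?_, fun p k g hk hg => ?_, fun p k g hk hg => ?_⟩⟩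
  · exact e.injective (CoprodI.Word.equiv.injective (CoprodI.Word.ext (Encodable.encode_injective h)))
  · constructor
    · intro h
      have h1 : CoprodI.Word.equiv (e g) = CoprodI.Word.empty := by
        refine CoprodI.Word.ext ?_
        simpa [CoprodI.Word.fstIdx] using h
      have h2 := congrArg CoprodI.Word.equiv.symm h1
      rw [Equiv.symm_apply_apply] at h2
      exact (MulEquiv.map_eq_one_iff e).1 h2
    · rintro rfl
      have h1 : CoprodI.Word.equiv (e 1) = CoprodI.Word.empty := by
        rw [map_one, ← Equiv.eq_symm_apply]
        rfl
      rw [h1]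
      rfl
  · generalize hw : CoprodI.Word.equiv (e g) = w at h
    induction w using CoprodI.Word.consRecOn with
    | empty => simp [CoprodI.Word.fstIdx] at h
    | cons q k w h1 h2 _ =>
      rw [CoprodI.Word.fstIdx_cons, Option.some_inj] at h
      subst h
      refine ⟨k, e.symm (CoprodI.Word.equiv.symm w), h2, ?_, ?_⟩
      · rw [← Equiv.eq_symm_apply] at hw
        rw [← e.symm_apply_apply g, hw]
        change e.symm (CoprodI.Word.prod _) = _
        rw [CoprodI.Word.prod_cons, map_mul]
        rfl
      · rwa [MulEquiv.apply_symm_apply, Equiv.apply_symm_apply]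
  · change Option.map _ (List.head? _) = _
    erw [hmul p k g hk hg]
    rfl
  · erw [hmul p k g hk hg]
    rw [Encodable.encode_list_cons]
    exact Nat.lt_succ_of_le (Nat.right_le_pair _ _)

end Construction

variable {G : Type} [Group G] {K : Bool → Type} [∀ p, Group (K p)] {ι : ∀ p, K p →* G}
  (d : FreeDecomp ι)

include d

lemma typ_one : d.typ 1 = none := (d.typ_eq_none 1).2 rfl

lemma exists_decomp (p : Bool) (g : G) : ∃ k g', g = ι p k * g' ∧ d.typ g' ≠ some p := by
  by_cases h : d.typ g = some p
  · obtain ⟨k, g', -, h1, h2⟩ := d.exists_eq g p h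
    exact ⟨k, g', h1, h2⟩
  · exact ⟨1, g, by simp, h⟩

lemma decomp_unique {p : Bool} {k k' : K p} {g g' : G} (hg : d.typ g ≠ some p)
    (hg' : d.typ g' ≠ some p) (h : ι p k * g = ι p k' * g') : k = k' ∧ g = g' := by
  have h1 : ι p (k'⁻¹ * k) * g = g' := by
    rw [map_mul, map_inv, mul_assoc, h, inv_mul_cancel_left]
  by_cases hk : k'⁻¹ * k = 1
  · rw [hk, map_one, one_mul] at h1
    exact ⟨(inv_mul_eq_one.1 hk).symm, h1⟩
  · exact absurd (h1 ▸ d.typ_mul p _ g hk hg) hg'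

lemma injective (p : Bool) : Function.Injective (ι p) := by
  intro k k' h
  refine (d.decomp_unique (p := p) (g := 1) (g' := 1) ?_ ?_ (by simpa using h)).1 <;>
    simp [d.typ_one]

lemma exists_word (g : G) :
    ∃ l : List (Bool × G), TwoSubgroups.Letters (fun p => (ι p).range) l ∧
      TwoSubgroups.ev l = g := by
  induction hn : d.code g using Nat.strong_induction_on generalizing g with
  | _ n ih =>
  cases h : d.typ g with
  | none =>
    rw [d.typ_eq_none] at h
    exact ⟨[], by simp [TwoSubgroups.Letters], h.symm⟩
  | some p =>
    obtain ⟨k, g', hk, rfl, hg'⟩ := d.exists_eq g p h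
    obtain ⟨l, hl, rfl⟩ := ih _ (hn ▸ d.code_lt p k g' hk hg') g' rfl
    refine ⟨l ++ [(p, ι p k)], fun a ha => ?_, ?_⟩
    · rcases List.mem_append.1 ha with ha | ha
      · exact hl a ha
      · rw [List.mem_singleton.1 ha]
        exact ⟨k, rfl⟩
    · simp [TwoSubgroups.ev_append, TwoSubgroups.ev]

end FreeDecomp

/-! ### The shift action -/

section Shift

lemma measurableSet_map_eq {α : Type*} (F : List α) (v : List ℕ) :
    MeasurableSet {z : α → ℕ | F.map z = v} := by
  induction F generalizing v with
  | nil => simp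
  | cons g F ih =>
    cases v with
    | nil => simp
    | cons n v =>
      simp only [List.map_cons, List.cons.injEq]
      exact (measurableSet_eq_fun (measurable_pi_apply g) measurable_const).inter (ih v)

variable {G : Type} [Group G]

lemma shift_one {X : Type*} (y : G → X) : shift 1 y = y := by
  funext β
  simp [shift]

lemma shift_mul {X : Type*} (g h : G) (y : G → X) : shift (g * h) y = shift g (shift h y) := by
  funext β
  simp [shift, mul_assoc]

lemma measurable_shift (g : G) : Measurable (shift g : (G → ℕ) → G → ℕ) :=
  measurable_pi_lambda _ fun β => measurable_pi_apply (g⁻¹ * β)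

lemma shift_mem_freePart {y : G → ℕ} {g : G} :
    shift g y ∈ freePart G ℕ ↔ y ∈ freePart G ℕ := by
  have key : ∀ (y : G → ℕ) (g : G), y ∈ freePart G ℕ → shift g y ∈ freePart G ℕ := by
    intro y g hy γ hγ h
    refine hy (g⁻¹ * γ * g) (fun h1 => hγ ?_) ?_
    · rwa [mul_assoc, inv_mul_eq_one, eq_comm, mul_eq_right] at h1
    · rw [shift_mul, shift_mul, h, ← shift_mul, inv_mul_cancel, shift_one]
  refine ⟨fun h => ?_, key y g⟩
  have := key _ g⁻¹ h
  rwa [← shift_mul, inv_mul_cancel, shift_one] at this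

variable [Countable G]

lemma measurableSet_shift_eq (g : G) : MeasurableSet {y : G → ℕ | shift g y = y} :=
  measurableSet_eq_fun (measurable_shift g) measurable_id

lemma measurableSet_freePart : MeasurableSet (freePart G ℕ) := by
  have : freePart G ℕ = ⋂ g ∈ {g : G | g ≠ 1}, {y : G → ℕ | shift g y = y}ᶜ := by
    ext y
    simp [freePart]
  rw [this]
  exact MeasurableSet.biInter (Set.to_countable _) fun g _ => (measurableSet_shift_eq g).compl

/-- The sets determined by finitely many coordinates separate finite sets of points. -/
lemma exists_separating : ∃ S : ℕ → Set (G → ℕ), (∀ j, MeasurableSet (S j)) ∧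
    ∀ Q Q' : Set (G → ℕ), Q.Finite → ∃ j, ∀ z ∈ Q, (z ∈ S j ↔ z ∈ Q') := by
  classical
  let T : List G × Finset (List ℕ) → Set (G → ℕ) := fun t => {z | t.1.map z ∈ t.2}
  have hT : ∀ t, MeasurableSet (T t) := fun t => by
    have : T t = ⋃ v ∈ t.2, {z | t.1.map z = v} := by
      ext z
      simp [T]
    rw [this]
    exact Finset.measurableSet_biUnion _ fun v _ => measurableSet_map_eq _ v
  obtain ⟨e, he⟩ := exists_surjective_nat (List G × Finset (List ℕ))
  refine ⟨fun j => T (e j), fun j => hT _, fun Q Q' hQ => ?_⟩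
  have hne : ∀ u : (G → ℕ) × (G → ℕ), ∃ g, u.1 ≠ u.2 → u.1 g ≠ u.2 g := by
    intro u
    by_cases h : u.1 = u.2
    · exact ⟨1, fun h' => absurd h h'⟩
    · obtain ⟨g, hg⟩ := Function.ne_iff.1 h
      exact ⟨g, fun _ => hg⟩
  choose w hw using hne
  let F : List G := ((hQ.prod hQ).image w).toFinset.toList
  let P : Finset (List ℕ) := ((hQ.inter_of_left Q').image fun z => F.map z).toFinset
  obtain ⟨j, hj⟩ := he (F, P)
  refine ⟨j, fun z hz => ?_⟩
  simp only [hj, T, P, Set.mem_ofPred_eq, Set.Finite.mem_toFinset, Set.mem_image]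
  constructor
  · rintro ⟨z', ⟨hz', hzQ'⟩, h⟩
    by_contra hzn
    have hne : z' ≠ z := fun h => hzn (h ▸ hzQ')
    refine hw (z', z) hne (List.map_inj_left.1 h _ ?_)
    simp only [F, Finset.mem_toList, Set.Finite.mem_toFinset]
    exact ⟨(z', z), ⟨hz', hz⟩, rfl⟩
  · exact fun h => ⟨z, ⟨hz, h⟩, rfl⟩

lemma exists_shift_coloring {H : Bool → Subgroup G}
    (hgen : ∀ g : G, ∃ l, TwoSubgroups.Letters H l ∧ TwoSubgroups.ev l = g) :
    ∃ c : Set (G → ℕ), MeasurableSet c ∧ ∀ y, y ∉ freePart G ℕ →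
      ∀ p, (∀ h ∈ H p, shift h y = y → h = 1) → ∃ h ∈ H p, (shift h y ∈ c ↔ p = true) := by
  let : MulAction G (G → ℕ) := {
    smul := shift
    one_smul := shift_one
    mul_smul := shift_mul }
  obtain ⟨S, hSm, hS⟩ := exists_separating (G := G)
  obtain ⟨c, hc, h⟩ := TwoSubgroups.exists_coloring (H := H) (X := G → ℕ) measurable_shift
    measurableSet_shift_eq hSm hS hgen
  refine ⟨c, hc, fun y hy => h y ?_⟩
  simp only [freePart, Set.mem_ofPred_eq] at hy
  push Not at hy
  exact hy

end Shift

/-! ### Simultaneous plays of games -/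

lemma measurable_of_res {X : Type*} [MeasurableSpace X] {v : X → ℕ → ℕ} {a : X → ℕ}
    (f : ℕ → List ℕ → ℕ) (n : ℕ) (ha : Measurable a) (hv : ∀ i < n, Measurable fun x => v x i) :
    Measurable fun x => f (a x) (PiNat.res (v x) n) := by
  let : MeasurableSpace (List ℕ) := ⊤
  have h : Measurable fun x => PiNat.res (v x) n := by
    induction n with
    | zero => exact measurable_const
    | succ n ih =>
      simp only [PiNat.res_succ]
      exact (Measurable.of_discrete (f := fun u : ℕ × List ℕ => u.1 :: u.2)).comp
        ((hv n n.lt_succ_self).prodMk (ih fun i hi => hv i (hi.trans n.lt_succ_self)))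
  exact (Measurable.of_discrete (f := fun u : ℕ × List ℕ => f u.1 u.2)).comp (ha.prodMk h)

section System

variable {K : Type} [Group K]

open Classical in
/-- The move at time `n` in the play at `κ`, where `v` holds the earlier moves of all plays. The
moves at times in `own` follow the strategy `s (x κ)`, the others are copied according to `opp`
from the labels `r ∘ x` or from the other plays. -/
noncomputable def nextMove (r : ℕ → ℕ) (s : ℕ → List ℕ → ℕ) (own : ℕ → Prop)
    (opp : ℕ → Option (K × Option ℕ)) (n : ℕ) (x : K → ℕ) (v : K → ℕ → ℕ) (κ : K) : ℕ :=
  if own n then s (x κ) (PiNat.res (v κ) n) else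
    match opp n with
    | none => 0
    | some (κ', none) => r (x (κ * κ'))
    | some (κ', some t) => v (κ * κ') t

open Classical in
/-- The first `n` moves of all plays. -/
noncomputable def plays (r : ℕ → ℕ) (s : ℕ → List ℕ → ℕ) (own : ℕ → Prop)
    (opp : ℕ → Option (K × Option ℕ)) : ℕ → (K → ℕ) → K → ℕ → ℕ
  | 0 => fun _ _ _ => 0
  | n + 1 => fun x κ => Function.update (plays r s own opp n x κ) n
      (nextMove r s own opp n x (plays r s own opp n x) κ)

theorem exists_plays (r : ℕ → ℕ) (s : ℕ → List ℕ → ℕ) (own : ℕ → Prop)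
    (opp : ℕ → Option (K × Option ℕ)) (hopp : ∀ n κ t, opp n = some (κ, some t) → t < n) :
    ∃ W : (K → ℕ) → K → ℕ → ℕ, (∀ κ n, Measurable fun x => W x κ n) ∧
      (∀ κ₀ x κ, W (shift κ₀ x) κ = W x (κ₀⁻¹ * κ)) ∧
      (∀ x κ n, own n → W x κ n = s (x κ) (PiNat.res (W x κ) n)) ∧
      (∀ x κ n κ', ¬ own n → opp n = some (κ', none) → W x κ n = r (x (κ * κ'))) ∧
      ∀ x κ n κ' t, ¬ own n → opp n = some (κ', some t) → W x κ n = W x (κ * κ') t := by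
  classical
  let V := plays r s own opp
  have hVsucc : ∀ n x κ, V (n + 1) x κ n = nextMove r s own opp n x (V n x) κ := fun n x κ =>
    Function.update_self ..
  have hVm : ∀ n κ i, Measurable fun x => V n x κ i := by
    intro n
    induction n with
    | zero => exact fun κ i => measurable_const
    | succ n ih =>
      intro κ i
      by_cases hi : i = n
      · subst hi
        simp only [hVsucc, nextMove]
        by_cases ho : own i
        · simp only [ho, if_true]
          exact measurable_of_res s i (measurable_pi_apply κ) fun j _ => ih κ j
        · simp only [ho, if_false]
          rcases opp i with _ | ⟨κ', _ | t⟩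
          · exact measurable_const
          · exact (Measurable.of_discrete (f := r)).comp (measurable_pi_apply _)
          · exact ih _ t
      · have : ∀ x, V (n + 1) x κ i = V n x κ i := fun x => Function.update_of_ne hi ..
        simp only [this]
        exact ih κ i
  have hVs : ∀ n κ₀ x κ, V n (shift κ₀ x) κ = V n x (κ₀⁻¹ * κ) := by
    intro n
    induction n with
    | zero => exact fun _ _ _ => rfl
    | succ n ih =>
      intro κ₀ x κ
      change Function.update (V n (shift κ₀ x) κ) n (nextMove r s own opp n _ (V n _) κ) =
        Function.update (V n x (κ₀⁻¹ * κ)) n (nextMove r s own opp n _ (V n _) _)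
      rw [ih]
      congr 1
      simp only [nextMove, ih, shift, mul_assoc]
  have hstab : ∀ n i x κ, i < n → V n x κ i = V (i + 1) x κ i := by
    intro n i x κ hi
    induction n with
    | zero => omega
    | succ n ih =>
      rcases Nat.lt_succ_iff_lt_or_eq.1 hi with h | rfl
      · rw [← ih h]
        exact Function.update_of_ne h.ne ..
      · rfl
  let W : (K → ℕ) → K → ℕ → ℕ := fun x κ n => V (n + 1) x κ n
  have hW : ∀ x κ n, W x κ n = nextMove r s own opp n x (V n x) κ := fun x κ n => hVsucc n x κ
  refine ⟨W, fun κ n => hVm _ κ n, fun κ₀ x κ => ?_, fun x κ n h => ?_, fun x κ n κ' h h' => ?_,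
    fun x κ n κ' t h h' => ?_⟩
  · funext n
    exact congrFun (hVs (n + 1) κ₀ x κ) n
  · rw [hW, nextMove, if_pos h]
    congr 1
    have : ∀ m ≤ n, PiNat.res (V n x κ) m = PiNat.res (W x κ) m := by
      intro m hm
      induction m with
      | zero => rfl
      | succ m ih => rw [PiNat.res_succ, PiNat.res_succ, ih (by omega), hstab n m x κ (by omega)]
    exact this n le_rfl
  · rw [hW, nextMove, if_neg h, h']
  · rw [hW, nextMove, if_neg h, h']
    exact hstab n t x _ (hopp n κ' t h')

end System

/-! ### The games -/

namespace FreeDecomp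

/-- The time at which the move for the word with code `n` is made, by the player who owns the
words starting in the factor `q`. -/
def turn (q : Bool) (n : ℕ) : ℕ := 2 * n + if q then 0 else 1

variable {G : Type} [Group G] {K : Bool → Type} [∀ p, Group (K p)] {ι : ∀ p, K p →* G}
  (d : FreeDecomp ι)

/-- The point built during a play `z` of the game with label `k`. -/
def outcome (k : ℕ) (z : ℕ → ℕ) (g : G) : ℕ :=
  match d.typ g with
  | none => k
  | some q => z (turn q (d.code g))

lemma measurable_outcome (k : ℕ) : Measurable (d.outcome k) := by
  refine measurable_pi_lambda _ fun g => ?_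
  unfold outcome
  cases d.typ g with
  | none => exact measurable_const
  | some q => exact measurable_pi_apply _

lemma turn_mod (q : Bool) (n : ℕ) : turn q n % 2 = if q then 0 else 1 := by
  cases q <;> simp [turn]

lemma turn_injective (q : Bool) : Function.Injective (turn q) := fun m n h => by
  simp only [turn] at h
  omega

lemma turn_lt {m n : ℕ} (q q' : Bool) (h : m < n) : turn q m < turn q' n := by
  cases q <;> cases q' <;> simp [turn] <;> omega

/-- Winning strategies for the games with labels `r j`, for the player who does not own the words
starting in the factor `p`, give rise to an equivariant map. -/
theorem exists_map (p : Bool) {B : Set (G → ℕ)} (r : ℕ → ℕ) (s : ℕ → List ℕ → ℕ)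
    (hs : ∀ j z, BorelGame.Follows (if p then 1 else 0) (s j) z → d.outcome (r j) z ∈ B) :
    ∃ Y : (K p → ℕ) → G → ℕ, Measurable Y ∧
      (∀ κ x, Y (shift κ x) = shift (ι p κ) (Y x)) ∧
      (∀ x κ, Y x (ι p κ) = r (x κ)) ∧ ∀ x κ, shift (ι p κ) (Y x) ∈ B := by
  classical
  let D : ℕ → K p × G → Prop := fun n u =>
    u.1 ≠ 1 ∧ d.typ u.2 ≠ some p ∧ n = turn p (d.code (ι p u.1 * u.2))
  let opp : ℕ → Option (K p × Option ℕ) := fun n => if h : ∃ u, D n u then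
    some (h.choose.1, if h.choose.2 = 1 then none else some (turn (!p) (d.code h.choose.2)))
    else none
  have hoppD : ∀ n u, D n u →
      opp n = some (u.1, if u.2 = 1 then none else some (turn (!p) (d.code u.2))) := by
    intro n u hu
    have h : ∃ u, D n u := ⟨u, hu⟩
    have h1 : h.choose = u := by
      obtain ⟨h1, h2, h3⟩ := h.choose_spec
      obtain ⟨h4, h5⟩ := d.decomp_unique h2 hu.2.1
        (d.code_injective (turn_injective p (h3.symm.trans hu.2.2)))
      exact Prod.ext h4 h5
    simp only [opp, dif_pos h, h1]
  have hopp : ∀ n κ t, opp n = some (κ, some t) → t < n := by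
    intro n κ t h
    by_cases hn : ∃ u, D n u
    · obtain ⟨u, hu⟩ := hn
      rw [hoppD n u hu] at h
      by_cases hu1 : u.2 = 1
      · simp [hu1] at h
      · simp only [hu1, if_false, Option.some_inj, Prod.mk.injEq] at h
        rw [← h.2, hu.2.2]
        exact turn_lt _ _ (d.code_lt p _ _ hu.1 hu.2.1)
    · simp only [opp, dif_neg hn, reduceCtorEq] at h
  obtain ⟨W, hWm, hWs, hWown, hWnone, hWsome⟩ :=
    exists_plays r s (fun n => n % 2 = if p then 1 else 0) opp hopp
  choose κ₁ g₁ hg₁ ht₁ using d.exists_decomp p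
  let Y : (K p → ℕ) → G → ℕ := fun x g =>
    if g₁ g = 1 then r (x (κ₁ g)) else W x (κ₁ g) (turn (!p) (d.code (g₁ g)))
  have hY : ∀ x κ g, d.typ g ≠ some p →
      Y x (ι p κ * g) = if g = 1 then r (x κ) else W x κ (turn (!p) (d.code g)) := by
    intro x κ g hg
    obtain ⟨h1, h2⟩ := d.decomp_unique (ht₁ (ι p κ * g)) hg (hg₁ _).symm
    simp only [Y, h1, h2]
  have hout : ∀ x κ g, Y x (ι p κ * g) = d.outcome (r (x κ)) (W x κ) g := by
    intro x κ g
    unfold outcome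
    rcases h : d.typ g with _ | q
    · rw [hY x κ g (by simp [h]), if_pos ((d.typ_eq_none g).1 h)]
    · have hg1 : g ≠ 1 := fun hg => by simp [(d.typ_eq_none g).2 hg] at h
      by_cases hq : q = p
      · subst hq
        obtain ⟨k, g', hk, rfl, hg'⟩ := d.exists_eq g q h
        rw [← mul_assoc, ← map_mul, hY _ _ _ hg']
        have hown : ¬ turn q (d.code (ι q k * g')) % 2 = if q then 1 else 0 := by
          rw [turn_mod]
          cases q <;> simp
        have ho := hoppD _ (k, g') ⟨hk, hg', rfl⟩
        by_cases h1 : g' = 1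
        · rw [if_pos h1] at ho ⊢
          exact (hWnone x κ _ k hown ho).symm
        · rw [if_neg h1] at ho ⊢
          exact (hWsome x κ _ k _ hown ho).symm
      · rw [hY x κ g (by simp [h, hq]), if_neg hg1]
        congr
        revert hq
        cases p <;> cases q <;> simp
  refine ⟨Y, measurable_pi_lambda _ fun g => ?_, fun κ x => ?_, fun x κ => ?_, fun x κ => ?_⟩
  · by_cases h : g₁ g = 1
    · simp only [Y, h, if_true]
      exact (Measurable.of_discrete (f := r)).comp (measurable_pi_apply _)
    · simp only [Y, h, if_false]
      exact hWm _ _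
  · funext g
    obtain ⟨k, g', rfl, hg'⟩ := d.exists_decomp p g
    change _ = Y x ((ι p κ)⁻¹ * (ι p k * g'))
    rw [← mul_assoc, ← map_inv, ← map_mul, hY _ _ _ hg', hY _ _ _ hg', hWs]
    rfl
  · rw [← mul_one (ι p κ), hY _ _ _ (by simp [d.typ_one]), if_pos rfl]
  · have h : shift (ι p κ) (Y x) = d.outcome (r (x κ⁻¹)) (W x κ⁻¹) := by
      funext g
      rw [← hout, map_inv]
      rfl
    rw [h]
    exact hs _ _ fun n hn => hWown x _ n hn

include d

/-- The equivariant map obtained from winning strategies takes values in the free part. -/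
theorem exists_map_freePart (p : Bool) (A : Set (freePart G ℕ)) {c : Set (G → ℕ)}
    (hc : ∀ y, y ∉ freePart G ℕ → (∀ h ∈ (ι p).range, shift h y = y → h = 1) →
      ∃ h ∈ (ι p).range, (shift h y ∈ c ↔ p = true))
    {r : ℕ → ℕ} (hr : Function.Injective r) (s : ℕ → List ℕ → ℕ)
    (hs : ∀ j z, BorelGame.Follows (if p then 1 else 0) (s j) z →
      (d.outcome (r j) z ∈ Subtype.val '' A ∪ ((freePart G ℕ)ᶜ ∩ cᶜ) ↔ p = true)) :
    ∃ f : freePart (K p) ℕ → freePart G ℕ, Function.Injective f ∧ Measurable f ∧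
      (∀ (γ : K p) (x y : freePart (K p) ℕ), (y : K p → ℕ) = shift γ (x : K p → ℕ) →
        (f y : G → ℕ) = shift (ι p γ) (f x : G → ℕ)) ∧ ∀ x, f x ∈ A ↔ p = true := by
  obtain ⟨Y, hYm, hYs, hYr, hYB⟩ := d.exists_map p
    (B := {y | y ∈ Subtype.val '' A ∪ ((freePart G ℕ)ᶜ ∩ cᶜ) ↔ p = true}) r s hs
  have hinj : Function.Injective Y := fun x x' h => by
    funext κ
    exact hr (by rw [← hYr, ← hYr, h])
  have hfree : ∀ x ∈ freePart (K p) ℕ, Y x ∈ freePart G ℕ := by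
    intro x hx
    by_contra hn
    obtain ⟨_, ⟨κ, rfl⟩, h2⟩ := hc (Y x) hn (by
      rintro _ ⟨κ, rfl⟩ h
      rw [← hYs] at h
      by_contra h1
      exact hx κ (fun h2 => h1 (by rw [h2, map_one])) (hinj h))
    have h3 := hYB x κ
    have h4 : shift (ι p κ) (Y x) ∉ freePart G ℕ := fun h => hn (shift_mem_freePart.1 h)
    have h5 : shift (ι p κ) (Y x) ∉ Subtype.val '' A := by
      rintro ⟨a, -, ha⟩
      exact h4 (ha ▸ a.2)
    simp only [Set.mem_ofPred_eq, Set.mem_union, h5, false_or, Set.mem_inter_iff, Set.mem_compl_iff,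
      h4, not_false_eq_true, true_and] at h3
    tauto
  refine ⟨fun x => ⟨Y x, hfree x x.2⟩, fun x x' h => Subtype.ext (hinj (congrArg Subtype.val h)),
    (hYm.comp measurable_subtype_coe).subtype_mk, fun γ x y h => ?_, fun x => ?_⟩
  · change Y y = shift _ (Y x)
    rw [h, hYs]
  · have h := hYB x 1
    rw [map_one, shift_one] at h
    rw [Set.mem_ofPred_eq] at h
    rw [← h]
    simp [hfree x x.2]

/-- One of the two players wins the games for infinitely many labels. -/
theorem exists_equivariant_map [Countable G] (A : Set (freePart G ℕ)) (hA : MeasurableSet A) :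
    ∃ p, ∃ f : freePart (K p) ℕ → freePart G ℕ, Function.Injective f ∧ Measurable f ∧
      (∀ (γ : K p) (x y : freePart (K p) ℕ), (y : K p → ℕ) = shift γ (x : K p → ℕ) →
        (f y : G → ℕ) = shift (ι p γ) (f x : G → ℕ)) ∧ ∀ x, f x ∈ A ↔ p = true := by
  obtain ⟨c, hcm, hc⟩ := exists_shift_coloring d.exists_word
  have hB : MeasurableSet (Subtype.val '' A ∪ ((freePart G ℕ)ᶜ ∩ cᶜ)) :=
    (MeasurableSet.subtype_image measurableSet_freePart hA).union
      (measurableSet_freePart.compl.inter hcm.compl)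
  have hwin : ∀ k, ∃ (p : Bool) (s : List ℕ → ℕ), ∀ z,
      BorelGame.Follows (if p then 1 else 0) s z →
      (d.outcome k z ∈ Subtype.val '' A ∪ ((freePart G ℕ)ᶜ ∩ cᶜ) ↔ p = true) := by
    intro k
    rcases BorelGame.borel_determinacy (d.measurable_outcome k hB.compl) with ⟨s, hs⟩ | ⟨s, hs⟩
    · exact ⟨false, s, fun z hz => iff_of_false (hs z hz) (by simp)⟩
    · exact ⟨true, s, fun z hz => iff_of_true (not_not.1 (hs z hz)) rfl⟩
  choose P s hs using hwin
  obtain ⟨p, hp⟩ := Finite.exists_infinite_fiber P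
  rw [Set.infinite_coe_iff] at hp
  let r : ℕ → ℕ := fun n => hp.natEmbedding _ n
  refine ⟨p, d.exists_map_freePart p A (fun y hy => hc y hy p) (r := r)
    (Subtype.val_injective.comp (hp.natEmbedding _).injective) (fun j => s (r j)) fun j z => ?_⟩
  have hrp : P (r j) = p := (hp.natEmbedding _ j).2
  have := hs (r j) z
  rwa [hrp] at this

end FreeDecomp

/-- The factors of a binary free product, as a family. -/
def factor (Γ Δ : Type) : Bool → Type
  | true => Γ
  | false => Δ

instance factorGroup (Γ Δ : Type) [Group Γ] [Group Δ] : ∀ p, Group (factor Γ Δ p)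
  | true => inferInstanceAs (Group Γ)
  | false => inferInstanceAs (Group Δ)

instance factorCountable (Γ Δ : Type) [Countable Γ] [Countable Δ] : ∀ p, Countable (factor Γ Δ p)
  | true => inferInstanceAs (Countable Γ)
  | false => inferInstanceAs (Countable Δ)

section

open Monoid

variable (Γ Δ : Type) [Group Γ] [Group Δ]

/-- The inclusions of the factors in the free product. -/
def factorHom : ∀ p, factor Γ Δ p →* Coprod Γ Δ
  | true => Coprod.inl
  | false => Coprod.inr

/-- The homomorphism from the binary to the indexed free product. -/
def coprodToCoprodI : Coprod Γ Δ →* CoprodI (factor Γ Δ) :=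
  Coprod.lift (CoprodI.of (M := factor Γ Δ) (i := true))
    (CoprodI.of (M := factor Γ Δ) (i := false))

lemma lift_comp_coprodToCoprodI :
    ((CoprodI.lift (factorHom Γ Δ)).comp (coprodToCoprodI Γ Δ)).comp Coprod.inl =
        (MonoidHom.id _).comp Coprod.inl ∧
      ((CoprodI.lift (factorHom Γ Δ)).comp (coprodToCoprodI Γ Δ)).comp Coprod.inr =
        (MonoidHom.id _).comp Coprod.inr := by
  constructor
  · ext x
    have h : coprodToCoprodI Γ Δ (Coprod.inl x) = CoprodI.of (M := factor Γ Δ) (i := true) x :=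
      Coprod.lift_apply_inl _ _ x
    have h' := CoprodI.lift_of (factorHom Γ Δ) (i := true) x
    rw [← h] at h'
    exact h'
  · ext x
    have h : coprodToCoprodI Γ Δ (Coprod.inr x) = CoprodI.of (M := factor Γ Δ) (i := false) x :=
      Coprod.lift_apply_inr _ _ x
    have h' := CoprodI.lift_of (factorHom Γ Δ) (i := false) x
    rw [← h] at h'
    exact h'

lemma coprodToCoprodI_comp : ∀ p,
    (((coprodToCoprodI Γ Δ).comp (CoprodI.lift (factorHom Γ Δ))).comp
      (CoprodI.of : factor Γ Δ p →* _)) = (MonoidHom.id _).comp CoprodI.of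
  | true => MonoidHom.ext fun x => (congrArg (coprodToCoprodI Γ Δ)
      (CoprodI.lift_of (factorHom Γ Δ) x)).trans (Coprod.lift_apply_inl _ _ x)
  | false => MonoidHom.ext fun x => (congrArg (coprodToCoprodI Γ Δ)
      (CoprodI.lift_of (factorHom Γ Δ) x)).trans (Coprod.lift_apply_inr _ _ x)

/-- A binary free product as an indexed free product. -/
def coprodEquivCoprodI : Coprod Γ Δ ≃* CoprodI (factor Γ Δ) :=
  MonoidHom.toMulEquiv (coprodToCoprodI Γ Δ) (CoprodI.lift (factorHom Γ Δ))
    (Coprod.hom_ext (lift_comp_coprodToCoprodI Γ Δ).1 (lift_comp_coprodToCoprodI Γ Δ).2)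
    (CoprodI.ext_hom _ _ (coprodToCoprodI_comp Γ Δ))

theorem nonempty_freeDecomp [Countable Γ] [Countable Δ] :
    Nonempty (FreeDecomp (factorHom Γ Δ)) := by
  have h := FreeDecomp.nonempty_of_mulEquiv (coprodEquivCoprodI Γ Δ)
  have : (fun p => ((coprodEquivCoprodI Γ Δ).symm : CoprodI (factor Γ Δ) →* Coprod Γ Δ).comp
      (CoprodI.of : factor Γ Δ p →* _)) = factorHom Γ Δ := by
    funext p
    exact MonoidHom.ext fun x => CoprodI.lift_of (factorHom Γ Δ) x
  rwa [this] at h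

end

/-- The main lemma: for any Borel subset `A` of `Free(ℕ^{Γ*Δ})`, either there is an
injective Borel `Γ`-equivariant map from `Free(ℕ^Γ)` into `A`, or there is an injective
Borel `Δ`-equivariant map from `Free(ℕ^Δ)` into the complement of `A`. -/
theorem stmt_0 (Γ Δ : Type) [Group Γ] [Group Δ] [Countable Γ] [Countable Δ]
    (A : Set ↥(freePart (Monoid.Coprod Γ Δ) ℕ)) (hA : MeasurableSet A) :
    (∃ f : ↥(freePart Γ ℕ) → ↥(freePart (Monoid.Coprod Γ Δ) ℕ),
      Function.Injective f ∧ Measurable f ∧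
      (∀ (γ : Γ) (x y : ↥(freePart Γ ℕ)),
        (y : Γ → ℕ) = shift γ (x : Γ → ℕ) →
        (f y : Monoid.Coprod Γ Δ → ℕ) =
          shift (Monoid.Coprod.inl γ) (f x : Monoid.Coprod Γ Δ → ℕ)) ∧
      Set.range f ⊆ A) ∨
    (∃ f : ↥(freePart Δ ℕ) → ↥(freePart (Monoid.Coprod Γ Δ) ℕ),
      Function.Injective f ∧ Measurable f ∧
      (∀ (δ : Δ) (x y : ↥(freePart Δ ℕ)),
        (y : Δ → ℕ) = shift δ (x : Δ → ℕ) →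
        (f y : Monoid.Coprod Γ Δ → ℕ) =
          shift (Monoid.Coprod.inr δ) (f x : Monoid.Coprod Γ Δ → ℕ)) ∧
      Set.range f ⊆ Aᶜ) := by
  obtain ⟨d⟩ := nonempty_freeDecomp Γ Δ
  have : Countable (Monoid.Coprod Γ Δ) := d.code_injective.countable
  obtain ⟨_ | _, f, hf, hfm, hfe, hfA⟩ := d.exists_equivariant_map A hA
  · refine Or.inr ⟨f, hf, hfm, hfe, ?_⟩
    rintro _ ⟨x, rfl⟩ h
    exact absurd ((hfA x).1 h) (by simp)
  · refine Or.inl ⟨f, hf, hfm, hfe, ?_⟩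
    rintro _ ⟨x, rfl⟩
    exact (hfA x).2 rfl
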